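/- For every K ∈ ℕ and every constant 0 < c < 1/2 there exist β > 0 and D₀ such that the following holds. Let G ∈ H(K) be a finite graph with δ(G) ≥ D₀, let x ∈ V(G), let p := 1/2 − c·√(log d(x)/d(x)), let A₀ be a p-random subset of V(G), and let (A_i) be the majority bootstrap percolation process started from A₀. Then Pr[x ∉ A₁₁] ≤ exp(−β·d(x)²). -/

import Mathlib

open SimpleGraph Filter

namespace MBP

/-- Degree of a vertex, via the cardinality of its neighbourhood. -/
noncomputable def deg {V : Type} (G : SimpleGraph V) (x : V) : ℕ :=
  (G.neighborSet x).ncard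

/-- Minimum degree. -/
noncomputable def minDeg {V : Type} (G : SimpleGraph V) : ℕ :=
  sInf (Set.range (deg G))

/-- Maximum degree. -/
noncomputable def maxDeg {V : Type} (G : SimpleGraph V) : ℕ :=
  sSup (Set.range (deg G))

/-- Ball of radius `ℓ` around `x`. -/
def ball {V : Type} (G : SimpleGraph V) (x : V) (ℓ : ℕ) : Set V :=
  {y | G.edist x y ≤ ℓ}

/-- Sphere of radius `ℓ` around `x` (for `ℓ ≥ 1` this is `B(x,ℓ) \ B(x,ℓ-1)`). -/
def sphere {V : Type} (G : SimpleGraph V) (x : V) (ℓ : ℕ) : Set V :=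
  {y | G.edist x y = ℓ}

/-- (P1) locally K-almost regular. -/
def P1 (K : ℕ) {V : Type} (G : SimpleGraph V) : Prop :=
  ∀ (x : V) (ℓ : ℕ), 1 ≤ ℓ → ∀ y ∈ sphere G x ℓ,
    |(deg G x : ℤ) - (deg G y : ℤ)| ≤ (K : ℤ) * ℓ

/-- (P2) K-bounded backwards expansion. -/
def P2 (K : ℕ) {V : Type} (G : SimpleGraph V) : Prop :=
  ∀ (x : V) (ℓ : ℕ), 1 ≤ ℓ → ∀ y ∈ sphere G x ℓ,
    (G.neighborSet y ∩ ball G x ℓ).ncard ≤ K * ℓ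

/-- `D` witnesses property (P3) (typical local structure and K-separation) at vertex `x`. -/
def P3At (K : ℕ) {V : Type} (G : SimpleGraph V) (x : V) (D : Set V) : Prop :=
  x ∉ D ∧ ∀ (ℓ : ℕ), 1 ≤ ℓ →
    ((D ∩ sphere G x ℓ).ncard ≤ K ^ (ℓ - 1) * (deg G x) ^ (ℓ - 1)) ∧
    (∀ y ∈ sphere G x ℓ \ D, (D ∩ G.neighborSet y).ncard ≤ K * ℓ) ∧
    (∀ y ∈ sphere G x ℓ \ D, ∀ z ∈ sphere G x ℓ \ D, y ≠ z →
      (G.neighborSet y ∩ G.neighborSet z ∩ (sphere G x (ℓ + 1) \ D)).ncard ≤ 1) ∧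
    (∀ y ∈ sphere G x ℓ \ D,
      (ball G y (2 * ℓ - 1) ∩ (sphere G x ℓ \ D)).ncard ≤ ℓ * K ^ (ℓ - 1) * (deg G x) ^ (ℓ - 1))

/-- (P3) typical local structure and K-separation. -/
def P3 (K : ℕ) {V : Type} (G : SimpleGraph V) : Prop :=
  ∀ x : V, ∃ D : Set V, P3At K G x D

/-- (P5) exponential order. -/
def P5 (K : ℕ) {V : Type} (G : SimpleGraph V) : Prop :=
  (Nat.card V : ℝ) ≤ Real.exp (K * minDeg G)

/-- (P4) K-projection, relative to a membership predicate `mem` for the projected subgraphs. -/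
def P4With (K : ℕ) {V : Type} (G : SimpleGraph V) (mem : G.Subgraph → Prop) : Prop :=
  ∀ (x : V) (ℓ : ℕ), 1 ≤ ℓ → ∀ y ∈ sphere G x ℓ,
    ∃ H : G.Subgraph, y ∈ H.verts ∧ mem H ∧
      H.verts ∩ ball G x (ℓ - 1) = ∅ ∧
      ∀ w : H.verts, |(deg H.coe w : ℤ) - (deg G (w : V) : ℤ)| ≤ (K : ℤ) * ℓ

/-- Membership in the class H(K) with recursion fuel `n`. -/
def HAux (K : ℕ) : ℕ → (V : Type) → SimpleGraph V → Prop
  | 0, V, _ => Nat.card V = 1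
  | n + 1, V, G =>
      Nat.card V = 1 ∨
        (P1 K G ∧ P2 K G ∧ P3 K G ∧ P4With K G (fun H => HAux K n H.verts H.coe) ∧ P5 K G)

/-- The class `H(K)` of geometric graphs: least class containing the one-vertex graph and
closed under properties (P1)–(P5), where the projections of (P4) again lie in the class. -/
def InH (K : ℕ) {V : Type} (G : SimpleGraph V) : Prop :=
  ∃ n, HAux K n V G

/-- One round of majority bootstrap percolation: a vertex `v` becomes infected if at least
`d(v)/2` of its neighbours are infected. -/
def bootStep {V : Type} (G : SimpleGraph V) (A : Set V) : Set V :=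
  A ∪ {v | (deg G v : ℝ) / 2 ≤ ((G.neighborSet v ∩ A).ncard : ℝ)}

/-- The majority bootstrap percolation process. -/
def bootIter {V : Type} (G : SimpleGraph V) (A0 : Set V) : ℕ → Set V
  | 0 => A0
  | n + 1 => bootStep G (bootIter G A0 n)

/-- `A0` percolates if eventually every vertex is infected. -/
def Percolates {V : Type} (G : SimpleGraph V) (A0 : Set V) : Prop :=
  (⋃ i, bootIter G A0 i) = Set.univ

/-- Weight of a subset `A` under the `p`-random measure. -/
noncomputable def weight {V : Type} (p : ℝ) (A : Set V) : ℝ :=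
  p ^ A.ncard * (1 - p) ^ (Aᶜ).ncard

/-- Probability that a `p`-random subset of `V` satisfies the event `E`. -/
noncomputable def prob {V : Type} (p : ℝ) (E : Set V → Prop) : ℝ :=
  ∑ᶠ A ∈ {A : Set V | E A}, weight p A

/-- Probability that a `p`-random initial set percolates. -/
noncomputable def Phi {V : Type} (p : ℝ) (G : SimpleGraph V) : ℝ :=
  prob p (fun A0 => Percolates G A0)

/-- One round of the `m`-shifted bootstrap process (threshold `d(v)/2 + m`). -/
def bootStepM {V : Type} (G : SimpleGraph V) (m : ℕ) (A : Set V) : Set V :=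
  A ∪ {v | (deg G v : ℝ) / 2 + m ≤ ((G.neighborSet v ∩ A).ncard : ℝ)}

/-- The `m`-shifted bootstrap process. -/
def bootIterM {V : Type} (G : SimpleGraph V) (m : ℕ) (A0 : Set V) : ℕ → Set V
  | 0 => A0
  | n + 1 => bootStepM G m (bootIterM G m A0 n)

/-- `σ(x) = √(log d(x) / d(x))`. -/
noncomputable def sigma' {V : Type} (G : SimpleGraph V) (x : V) : ℝ :=
  Real.sqrt (Real.log (deg G x) / (deg G x))

/-- `γ(x) = √(d(x) / √(log d(x)))`. -/
noncomputable def gamma' {V : Type} (G : SimpleGraph V) (x : V) : ℝ :=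
  Real.sqrt ((deg G x : ℝ) / Real.sqrt (Real.log (deg G x)))

/-- The `Boot₂(γ)` process: in the step from round `ℓ` to round `ℓ+1`, a vertex `v` becomes
infected if at least `d(v)/2 - max(0, 2-ℓ)·γ(v)` of its neighbours are infected. -/
noncomputable def hatIter {V : Type} (G : SimpleGraph V) (A0 : Set V) : ℕ → Set V
  | 0 => A0
  | ℓ + 1 =>
      hatIter G A0 ℓ ∪
        {v | (deg G v : ℝ) / 2 - ((2 - ℓ : ℕ) : ℝ) * gamma' G v
              ≤ ((G.neighborSet v ∩ hatIter G A0 ℓ).ncard : ℝ)}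

/-- Expectation of `f` restricted to the event `E`, under the `p`-random measure. -/
noncomputable def expOn {V : Type} (p : ℝ) (E : Set V → Prop) (f : Set V → ℝ) : ℝ :=
  ∑ᶠ A ∈ {A : Set V | E A}, weight p A * f A

/-- Conditional expectation of `f` given the event `E`. -/
noncomputable def condExp {V : Type} (p : ℝ) (E : Set V → Prop) (f : Set V → ℝ) : ℝ :=
  expOn p E f / prob p E

/-- Conditional variance of `f` given the event `E`. -/
noncomputable def condVar {V : Type} (p : ℝ) (E : Set V → Prop) (f : Set V → ℝ) : ℝ :=
  condExp p E (fun A => (f A - condExp p E f) ^ 2)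

/-- The number of edges between `U` and `W` (ordered pairs `(u,w)` with `u ∈ U`, `w ∈ W`
adjacent; for disjoint sets this is the number of edges with one endpoint in each). -/
noncomputable def eBetween {V : Type} (G : SimpleGraph V) (U W : Set V) : ℕ :=
  {e : V × V | e.1 ∈ U ∧ e.2 ∈ W ∧ G.Adj e.1 e.2}.ncard

/-- Upper tail `Pr[Bin(d,p) ≥ t]` of the binomial distribution. -/
noncomputable def binTail (d : ℕ) (p : ℝ) (t : ℝ) : ℝ :=
  ∑ k ∈ Finset.range (d + 1),
    if t ≤ (k : ℝ) then (d.choose k : ℝ) * p ^ k * (1 - p) ^ (d - k) else 0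

section ProbPart

open Finset

variable {V : Type}

lemma prob_eq_sum [Fintype V] (p : ℝ) (E : Set V → Prop) [DecidablePred E] :
    prob p E = ∑ A : Set V, if E A then weight p A else 0 := by
  classical
  unfold prob
  rw [finsum_mem_eq_finite_toFinset_sum _ (Set.toFinite _), ← Finset.sum_filter]
  apply Finset.sum_congr _ (fun _ _ => rfl)
  ext A
  simp

lemma weight_nonneg' {p : ℝ} (h0 : 0 ≤ p) (h1 : p ≤ 1) (A : Set V) : 0 ≤ weight p A := by
  unfold weight
  have : 0 ≤ 1 - p := by linarith
  positivity

/-- Expectation over a random subset of `U`. -/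
noncomputable def Ex [DecidableEq V] (p : ℝ) (U : Finset V) (f : Finset V → ℝ) : ℝ :=
  ∑ A ∈ U.powerset, p ^ #A * (1 - p) ^ #(U \ A) * f A

lemma prob_eq_Ex [Fintype V] [DecidableEq V] (p : ℝ) (E : Set V → Prop) [DecidablePred E] :
    prob p E = Ex p Finset.univ (fun A : Finset V => if E (A : Set V) then 1 else 0) := by
  classical
  rw [prob_eq_sum]
  unfold Ex
  rw [Finset.powerset_univ]
  symm
  apply Fintype.sum_equiv Fintype.finsetEquivSet
  intro A
  have h1 : (A : Set V).ncard = #A := Set.ncard_coe_finset A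
  have h2 : ((A : Set V)ᶜ).ncard = #(Finset.univ \ A) := by
    rw [← Set.ncard_coe_finset]; congr 1; ext; simp
  simp only [Fintype.finsetEquivSet_apply, weight, h1, h2]
  split_ifs <;> simp

lemma Ex_empty [DecidableEq V] (p : ℝ) (f : Finset V → ℝ) : Ex p ∅ f = f ∅ := by
  simp [Ex]

lemma Ex_insert [DecidableEq V] (p : ℝ) {a : V} {U : Finset V} (ha : a ∉ U)
    (f : Finset V → ℝ) :
    Ex p (insert a U) f = (1 - p) * Ex p U f + p * Ex p U (fun A => f (insert a A)) := by
  unfold Ex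
  rw [Finset.sum_powerset_insert ha, Finset.mul_sum, Finset.mul_sum]
  congr 1
  · apply Finset.sum_congr rfl
    intro A hA
    rw [Finset.mem_powerset] at hA
    have haA : a ∉ A := fun h => ha (hA h)
    rw [Finset.insert_sdiff_of_notMem _ haA, Finset.card_insert_of_notMem (by simp [ha])]
    ring
  · apply Finset.sum_congr rfl
    intro A hA
    rw [Finset.mem_powerset] at hA
    have haA : a ∉ A := fun h => ha (hA h)
    rw [Finset.card_insert_of_notMem haA]
    have : insert a U \ insert a A = U \ A := by
      ext z; simp only [Finset.mem_sdiff, Finset.mem_insert]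
      constructor
      · rintro ⟨h1 | h1, h2⟩
        · exact absurd (Or.inl h1) h2
        · exact ⟨h1, fun h => h2 (Or.inr h)⟩
      · rintro ⟨h1, h2⟩
        refine ⟨Or.inr h1, ?_⟩
        rintro (h | h)
        · exact ha (h ▸ h1)
        · exact h2 h
    rw [this]
    ring

lemma Ex_congr [DecidableEq V] (p : ℝ) (U : Finset V) {f g : Finset V → ℝ}
    (h : ∀ A ⊆ U, f A = g A) : Ex p U f = Ex p U g := by
  unfold Ex
  apply Finset.sum_congr rfl
  intro A hA
  rw [h A (Finset.mem_powerset.1 hA)]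

lemma Ex_add [DecidableEq V] (p : ℝ) (U : Finset V) (f g : Finset V → ℝ) :
    Ex p U (fun A => f A + g A) = Ex p U f + Ex p U g := by
  unfold Ex
  rw [← Finset.sum_add_distrib]
  apply Finset.sum_congr rfl; intros; ring

lemma Ex_mul_left [DecidableEq V] (p : ℝ) (U : Finset V) (c : ℝ) (g : Finset V → ℝ) :
    Ex p U (fun A => c * g A) = c * Ex p U g := by
  unfold Ex
  rw [Finset.mul_sum]
  apply Finset.sum_congr rfl; intros; ring

lemma Ex_mono [DecidableEq V] {p : ℝ} (h0 : 0 ≤ p) (h1 : p ≤ 1) (U : Finset V)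
    {f g : Finset V → ℝ} (h : ∀ A ⊆ U, f A ≤ g A) : Ex p U f ≤ Ex p U g := by
  unfold Ex
  apply Finset.sum_le_sum
  intro A hA
  have : 0 ≤ 1 - p := by linarith
  exact mul_le_mul_of_nonneg_left (h A (Finset.mem_powerset.1 hA)) (by positivity)

lemma Ex_union [DecidableEq V] (p : ℝ) (U W : Finset V) (h : Disjoint U W)
    (f : Finset V → ℝ) :
    Ex p (U ∪ W) f = Ex p U (fun A => Ex p W (fun B => f (A ∪ B))) := by
  induction U using Finset.induction_on generalizing f with
  | empty => simp [Ex_empty]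
  | insert a U ha ih =>
    rw [Finset.disjoint_insert_left] at h
    have ha' : a ∉ U ∪ W := by simp [ha, h.1]
    rw [Finset.insert_union, Ex_insert p ha', Ex_insert p ha, ih h.2, ih h.2]
    simp only [Finset.insert_union]

lemma Ex_one [DecidableEq V] (p : ℝ) (U : Finset V) (c : ℝ) : Ex p U (fun _ => c) = c := by
  induction U using Finset.induction_on with
  | empty => simp [Ex_empty]
  | insert a U ha ih => rw [Ex_insert p ha, ih]; ring

lemma Ex_indep [Fintype V] [DecidableEq V] (p : ℝ) (U : Finset V) (f g : Finset V → ℝ)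
    (hf : ∀ A, f A = f (A ∩ U)) (hg : ∀ A, g A = g (A \ U)) :
    Ex p Finset.univ (fun A => f A * g A) = Ex p Finset.univ f * Ex p Finset.univ g := by
  have hu : (Finset.univ : Finset V) = U ∪ Uᶜ := by simp
  have hd : Disjoint U Uᶜ := disjoint_compl_right
  rw [hu, Ex_union _ _ _ hd, Ex_union _ _ _ hd, Ex_union _ _ _ hd]
  have key : ∀ A ⊆ U, ∀ B ⊆ Uᶜ, (A ∪ B) ∩ U = A ∧ (A ∪ B) \ U = B := by
    intro A hA B hB
    constructor
    · ext z
      have := @hA z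
      have := @hB z
      simp only [Finset.mem_compl, Finset.mem_inter, Finset.mem_union] at *
      tauto
    · ext z
      have := @hA z
      have := @hB z
      simp only [Finset.mem_compl, Finset.mem_sdiff, Finset.mem_union] at *
      tauto
  have e1 : Ex p U (fun A => Ex p Uᶜ (fun B => f (A ∪ B) * g (A ∪ B)))
      = Ex p U (fun A => Ex p Uᶜ g * f A) := by
    apply Ex_congr; intro A hA
    rw [mul_comm (Ex p Uᶜ g), ← Ex_mul_left]
    apply Ex_congr; intro B hB
    rw [hf (A ∪ B), hg (A ∪ B), (key A hA B hB).1, (key A hA B hB).2]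
  have e2 : Ex p U (fun A => Ex p Uᶜ (fun B => f (A ∪ B))) = Ex p U f := by
    apply Ex_congr; intro A hA
    rw [← Ex_one p Uᶜ (f A)]
    apply Ex_congr; intro B hB
    rw [hf (A ∪ B), (key A hA B hB).1]
  have e3 : Ex p U (fun A => Ex p Uᶜ (fun B => g (A ∪ B))) = Ex p Uᶜ g := by
    rw [← Ex_one p U (Ex p Uᶜ g)]
    apply Ex_congr; intro A hA
    apply Ex_congr; intro B hB
    rw [hg (A ∪ B), (key A hA B hB).2]
  rw [e1, e2, e3, Ex_mul_left, mul_comm]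

lemma Ex_local [Fintype V] [DecidableEq V] (p : ℝ) (U : Finset V) (f : Finset V → ℝ) :
    Ex p Finset.univ (fun A => f (A ∩ U)) = Ex p U f := by
  have hu : (Finset.univ : Finset V) = U ∪ Uᶜ := by simp
  have hd : Disjoint U Uᶜ := disjoint_compl_right
  rw [hu, Ex_union _ _ _ hd]
  apply Ex_congr; intro A hA
  rw [← Ex_one p Uᶜ (f A)]
  apply Ex_congr; intro B hB
  congr 1
  ext z
  have := @hA z
  have := @hB z
  simp only [Finset.mem_compl, Finset.mem_inter, Finset.mem_union] at *
  tauto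

lemma Ex_card [DecidableEq V] (p : ℝ) (U : Finset V) (g : ℕ → ℝ) :
    Ex p U (fun A => g #A) =
      ∑ j ∈ Finset.range (#U + 1), (#U).choose j * (p ^ j * (1 - p) ^ (#U - j) * g j) := by
  unfold Ex
  have : ∀ A ∈ U.powerset, p ^ #A * (1 - p) ^ #(U \ A) * g #A
      = (fun j => p ^ j * (1 - p) ^ (#U - j) * g j) #A := by
    intro A hA
    rw [Finset.card_sdiff_of_subset (Finset.mem_powerset.1 hA)]
  rw [Finset.sum_congr rfl this, Finset.sum_powerset_apply_card (fun j => p ^ j * (1 - p) ^ (#U - j) * g j)]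
  simp [nsmul_eq_mul]

/-! Probability facts -/

/-- The event `E` is determined by the coordinates in `U`. -/
def Det (U : Set V) (E : Set V → Prop) : Prop :=
  ∀ A B : Set V, A ∩ U = B ∩ U → (E A ↔ E B)

lemma prob_mono [Finite V] {p : ℝ} (h0 : 0 ≤ p) (h1 : p ≤ 1) {E F : Set V → Prop}
    (h : ∀ A, E A → F A) : prob p E ≤ prob p F := by
  classical
  have := Fintype.ofFinite V
  rw [prob_eq_sum, prob_eq_sum]
  apply Finset.sum_le_sum
  intro A _
  by_cases hE : E A
  · simp [hE, h A hE]
  · simp only [hE, if_false]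
    split_ifs
    · exact weight_nonneg' h0 h1 A
    · exact le_rfl

lemma prob_nonneg [Finite V] {p : ℝ} (h0 : 0 ≤ p) (h1 : p ≤ 1) (E : Set V → Prop) :
    0 ≤ prob p E := by
  classical
  have := Fintype.ofFinite V
  rw [prob_eq_sum]
  apply Finset.sum_nonneg
  intro A _
  split_ifs
  · exact weight_nonneg' h0 h1 A
  · exact le_rfl

lemma prob_true [Finite V] (p : ℝ) : prob p (fun _ : Set V => True) = 1 := by
  classical
  have := Fintype.ofFinite V
  rw [prob_eq_Ex]
  simp [Ex_one]

lemma prob_not [Finite V] (p : ℝ) (E : Set V → Prop) :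
    prob p (fun A => ¬ E A) = 1 - prob p E := by
  classical
  have := Fintype.ofFinite V
  have h := prob_true (V := V) p
  rw [prob_eq_sum] at h
  rw [prob_eq_sum, prob_eq_sum, ← h, eq_sub_iff_add_eq, ← Finset.sum_add_distrib]
  apply Finset.sum_congr rfl
  intro A _
  by_cases hE : E A <;> simp [hE]

lemma prob_or [Finite V] {p : ℝ} (h0 : 0 ≤ p) (h1 : p ≤ 1) (E F : Set V → Prop) :
    prob p (fun A => E A ∨ F A) ≤ prob p E + prob p F := by
  classical
  have := Fintype.ofFinite V
  rw [prob_eq_sum, prob_eq_sum, prob_eq_sum, ← Finset.sum_add_distrib]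
  apply Finset.sum_le_sum
  intro A _
  have := weight_nonneg' h0 h1 A
  by_cases hE : E A <;> by_cases hF : F A <;> simp [hE, hF, this]

lemma prob_exists [Finite V] {p : ℝ} (h0 : 0 ≤ p) (h1 : p ≤ 1) {ι : Type*} (s : Finset ι)
    (E : ι → Set V → Prop) :
    prob p (fun A => ∃ i ∈ s, E i A) ≤ ∑ i ∈ s, prob p (E i) := by
  classical
  induction s using Finset.induction_on with
  | empty =>
    have := Fintype.ofFinite V
    rw [prob_eq_sum]
    simp
  | insert a s ha ih =>
    rw [Finset.sum_insert ha]
    refine le_trans ?_ (add_le_add_right ih _)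
    refine le_trans ?_ (prob_or h0 h1 _ _)
    apply prob_mono h0 h1
    intro A
    simp

lemma prob_and [Finite V] (p : ℝ) {U W : Set V} (hd : Disjoint U W) {E F : Set V → Prop}
    (hE : Det U E) (hF : Det W F) :
    prob p (fun A => E A ∧ F A) = prob p E * prob p F := by
  classical
  have := Fintype.ofFinite V
  rw [prob_eq_Ex, prob_eq_Ex, prob_eq_Ex, ← Ex_indep p U.toFinset]
  · apply Ex_congr
    intro A _
    by_cases h1 : E A <;> by_cases h2 : F A <;> simp [h1, h2]
  · intro A
    have := hE (A : Set V) ((A ∩ U.toFinset : Finset V) : Set V) (by ext; simp)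
    simp only [this]
  · intro A
    have := hF (A : Set V) ((A \ U.toFinset : Finset V) : Set V) (by
      ext z
      simp only [Set.mem_inter_iff, Finset.mem_coe, Finset.mem_sdiff, Set.mem_toFinset]
      have h3 : z ∈ U → z ∉ W := fun h => Set.disjoint_left.1 hd h
      tauto)
    simp only [this]

lemma prob_forall [Finite V] (p : ℝ) {ι : Type*} (s : Finset ι) (U : ι → Set V)
    (E : ι → Set V → Prop) (hE : ∀ i ∈ s, Det (U i) (E i))
    (hd : ∀ i ∈ s, ∀ j ∈ s, i ≠ j → Disjoint (U i) (U j)) :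
    prob p (fun A => ∀ i ∈ s, E i A) = ∏ i ∈ s, prob p (E i) := by
  classical
  induction s using Finset.induction_on with
  | empty => simpa using prob_true p
  | insert a s ha ih =>
    rw [Finset.prod_insert ha, ← ih (fun i hi => hE i (Finset.mem_insert_of_mem hi))
      (fun i hi j hj => hd i (Finset.mem_insert_of_mem hi) j (Finset.mem_insert_of_mem hj))]
    rw [← prob_and p (U := U a) (W := ⋃ i ∈ s, U i)]
    · congr 1
      ext A
      simp
    · rw [Set.disjoint_iUnion₂_right]
      intro i hi
      exact hd a (Finset.mem_insert_self _ _) i (Finset.mem_insert_of_mem hi)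
        (fun h => ha (h ▸ hi))
    · exact hE a (Finset.mem_insert_self _ _)
    · intro A B hAB
      apply forall₂_congr
      intro i hi
      apply hE i (Finset.mem_insert_of_mem hi)
      ext z
      have := Set.ext_iff.1 hAB z
      simp only [Set.mem_inter_iff, Set.mem_iUnion] at *
      constructor
      · rintro ⟨h1, h2⟩
        exact ⟨(this.1 ⟨h1, ⟨i, hi, h2⟩⟩).1, h2⟩
      · rintro ⟨h1, h2⟩
        exact ⟨(this.2 ⟨h1, ⟨i, hi, h2⟩⟩).1, h2⟩

lemma prob_notMem [Finite V] (p : ℝ) (y : V) : prob p (fun A => y ∉ A) = 1 - p := by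
  classical
  have := Fintype.ofFinite V
  rw [prob_eq_Ex]
  have := Ex_local p ({y} : Finset V) (fun A => if y ∉ A then 1 else 0)
  simp only [Finset.mem_inter, Finset.mem_singleton, and_true] at this
  simp only [Finset.mem_coe]
  rw [this, ← insert_empty_eq, Ex_insert p (by simp), Ex_empty, Ex_empty]
  simp

/-- binomial lower bound -/
lemma prob_binom_ge [Finite V] {p : ℝ} (h0 : 0 ≤ p) (h1 : p ≤ 1) (P : Set V) (t : ℝ)
    (J : Finset ℕ) (hJ : ∀ j ∈ J, j ≤ P.ncard ∧ t ≤ j) :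
    ∑ j ∈ J, (P.ncard).choose j * (p ^ j * (1 - p) ^ (P.ncard - j))
      ≤ prob p (fun A => t ≤ ((P ∩ A).ncard : ℝ)) := by
  classical
  have := Fintype.ofFinite V
  have hP : P.ncard = #P.toFinset := by rw [Set.ncard_eq_toFinset_card']
  have h := Ex_local p P.toFinset (fun A => if t ≤ (#A : ℝ) then 1 else 0)
  rw [Ex_card p P.toFinset (fun j => if t ≤ (j : ℝ) then 1 else 0)] at h
  rw [prob_eq_Ex]
  have e : ∀ A : Finset V, (P ∩ (A : Set V)).ncard = #(A ∩ P.toFinset) := by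
    intro A
    rw [← Set.ncard_coe_finset]; congr 1; ext; simp [and_comm]
  simp only [e]
  rw [h, hP]
  rw [hP] at hJ
  have hp : 0 ≤ 1 - p := by linarith
  refine le_trans (le_of_eq ?_) (Finset.sum_le_sum_of_subset_of_nonneg (s := J) ?_ ?_)
  · apply Finset.sum_congr rfl
    intro j hj
    simp [(hJ j hj).2]
  · intro j hj
    have := (hJ j hj).1
    rw [Finset.mem_range]; omega
  · intro j _ _
    split_ifs <;> positivity

/-- Chernoff -/
lemma prob_chernoff [Finite V] {p : ℝ} (h0 : 0 ≤ p) (h1 : p ≤ 1) (P : Set V) (t l : ℝ)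
    (hl : 0 ≤ l) :
    prob p (fun A => ((P ∩ A).ncard : ℝ) < t)
      ≤ Real.exp (l * t) * (p * Real.exp (-l) + (1 - p)) ^ P.ncard := by
  classical
  have := Fintype.ofFinite V
  have hP : P.ncard = #P.toFinset := by rw [Set.ncard_eq_toFinset_card']
  have h := Ex_local p P.toFinset (fun A => Real.exp (l * t) * Real.exp (-l) ^ #A)
  rw [Ex_mul_left p P.toFinset, Ex_card p P.toFinset (fun j => Real.exp (-l) ^ j)] at h
  rw [prob_eq_Ex]
  have e : ∀ A : Finset V, (P ∩ (A : Set V)).ncard = #(A ∩ P.toFinset) := by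
    intro A
    rw [← Set.ncard_coe_finset]; congr 1; ext; simp [and_comm]
  simp only [e]
  have hs : (p * Real.exp (-l) + (1 - p)) ^ P.ncard = ∑ j ∈ Finset.range (#P.toFinset + 1),
      (#P.toFinset).choose j * (p ^ j * (1 - p) ^ (#P.toFinset - j) * Real.exp (-l) ^ j) := by
    rw [add_pow, hP]
    apply Finset.sum_congr rfl
    intro j _
    rw [mul_pow]; ring
  rw [hs, ← h]
  apply Ex_mono h0 h1
  intro A _
  split_ifs with hlt
  · rw [← Real.exp_nat_mul, ← Real.exp_add]
    apply Real.one_le_exp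
    nlinarith
  · positivity

end ProbPart


section GraphPart

open Finset

variable {V : Type} (G : SimpleGraph V)

lemma mem_ball_succ_of_adj {x w z : V} {j : ℕ} (hw : w ∈ ball G x j) (h : G.Adj w z) :
    z ∈ ball G x (j + 1) := by
  unfold ball at *
  simp only [Set.mem_ofPred_eq] at *
  calc G.edist x z ≤ G.edist x w + G.edist w z := G.edist_triangle
    _ ≤ j + 1 := by
      rw [SimpleGraph.edist_eq_one_iff_adj.2 h]
      gcongr
    _ = ((j + 1 : ℕ) : ℕ∞) := by push_cast; rfl

lemma sphere_subset_ball (x : V) (j : ℕ) : sphere G x j ⊆ ball G x j := by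
  intro y hy
  unfold ball sphere at *
  simp only [Set.mem_ofPred_eq] at *
  rw [hy]

lemma ball_mono (x : V) {i j : ℕ} (h : i ≤ j) : ball G x i ⊆ ball G x j := by
  intro y hy
  unfold ball at *
  simp only [Set.mem_ofPred_eq] at *
  exact hy.trans (by exact_mod_cast h)

lemma ball_sub_of_adj {y z : V} (h : G.Adj y z) (k : ℕ) : ball G z k ⊆ ball G y (k + 1) := by
  intro u hu
  unfold ball at *
  simp only [Set.mem_ofPred_eq] at *
  calc G.edist y u ≤ G.edist y z + G.edist z u := G.edist_triangle
    _ ≤ 1 + k := by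
      rw [SimpleGraph.edist_eq_one_iff_adj.2 h]
      gcongr
    _ = ((k + 1 : ℕ) : ℕ∞) := by push_cast; rw [add_comm]

lemma mem_sphere_of_ball {x z : V} {j : ℕ} (h : z ∈ ball G x (j + 1)) (h' : z ∉ ball G x j) :
    z ∈ sphere G x (j + 1) := by
  unfold ball sphere at *
  simp only [Set.mem_ofPred_eq, not_le] at *
  apply le_antisymm h
  push_cast
  exact Order.add_one_le_of_lt h'

lemma not_mem_ball_of_sphere {x z : V} {j : ℕ} (h : z ∈ sphere G x (j + 1)) :
    z ∉ ball G x j := by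
  unfold ball sphere at *
  simp only [Set.mem_ofPred_eq, not_le] at *
  rw [h]
  exact_mod_cast Nat.lt_succ_self j

lemma self_mem_sphere (x : V) : x ∈ sphere G x 0 := by
  simp [sphere]

lemma mem_ball_zero {x z : V} : z ∈ ball G x 0 ↔ z = x := by
  simp only [ball, Set.mem_ofPred_eq, Nat.cast_zero, nonpos_iff_eq_zero,
    SimpleGraph.edist_eq_zero_iff]
  exact eq_comm

lemma adj_mem_sphere_one {x z : V} : z ∈ sphere G x 1 ↔ G.Adj x z := by
  simp [sphere]

lemma boot_local (k : ℕ) : ∀ (y : V) (A B : Set V), A ∩ ball G y k = B ∩ ball G y k →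
    (y ∈ bootIter G A k ↔ y ∈ bootIter G B k) := by
  induction k with
  | zero =>
    intro y A B h
    have := Set.ext_iff.1 h y
    have hy : y ∈ ball G y 0 := (mem_ball_zero G).2 rfl
    simpa [hy, bootIter] using this
  | succ k ih =>
    intro y A B h
    have sub : ∀ S : Set V, S ⊆ ball G y (k + 1) → A ∩ S = B ∩ S := by
      intro S hS
      ext z
      have := Set.ext_iff.1 h z
      simp only [Set.mem_inter_iff] at *
      have := @hS z
      tauto
    have h1 := ih y A B (sub _ (ball_mono G y (Nat.le_succ k)))
    have h2 : G.neighborSet y ∩ bootIter G A k = G.neighborSet y ∩ bootIter G B k := by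
      ext z
      simp only [Set.mem_inter_iff, SimpleGraph.mem_neighborSet]
      apply and_congr_right
      intro hz
      exact ih z A B (sub _ (ball_sub_of_adj G hz k))
    simp only [bootIter, bootStep, Set.mem_union, Set.mem_ofPred_eq, h1, h2]

lemma boot_det (k : ℕ) (y : V) : Det (ball G y k) (fun A => y ∉ bootIter G A k) := by
  intro A B h
  exact not_congr (boot_local G k y A B h)

lemma ball_disjoint {y z : V} {k m : ℕ} (hkm : 2 * k ≤ m) (h : z ∉ ball G y m) :
    Disjoint (ball G y k) (ball G z k) := by
  rw [Set.disjoint_left]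
  intro u hu hu'
  apply h
  unfold ball at *
  simp only [Set.mem_ofPred_eq] at *
  calc G.edist y z ≤ G.edist y u + G.edist u z := G.edist_triangle
    _ ≤ k + k := by
      rw [G.edist_comm (u := u)]
      gcongr
    _ = ((2 * k : ℕ) : ℕ∞) := by push_cast; rw [two_mul]
    _ ≤ m := by exact_mod_cast hkm

lemma exists_pred {x y : V} {j : ℕ} (h : y ∈ sphere G x (j + 1)) :
    ∃ w ∈ sphere G x j, G.Adj w y := by
  have h0 : G.edist x y = ((j + 1 : ℕ) : ℕ∞) := h
  obtain ⟨p, hp⟩ := SimpleGraph.exists_walk_of_edist_eq_coe h0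
  refine ⟨p.getVert j, ?_, ?_⟩
  · have ha : G.Adj (p.getVert j) y := by
      have := p.adj_getVert_succ (i := j) (by omega)
      rwa [← hp, p.getVert_length] at this
    have h1 : G.edist x (p.getVert j) ≤ j := by
      refine (SimpleGraph.edist_le (p.take j)).trans ?_
      exact_mod_cast (by simp : (p.take j).length ≤ j)
    cases j with
    | zero =>
      have : p.getVert 0 ∈ ball G x 0 := h1
      rw [mem_ball_zero] at this
      rw [this]; exact self_mem_sphere G x
    | succ i =>
      apply mem_sphere_of_ball G h1
      intro hb
      exact not_mem_ball_of_sphere G h (mem_ball_succ_of_adj G hb ha)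
  · have := p.adj_getVert_succ (i := j) (by omega)
    rwa [← hp, p.getVert_length] at this

lemma deg_le_of_P1 {K : ℕ} (h1 : P1 K G) {x y : V} {j : ℕ} (hy : y ∈ sphere G x j) :
    deg G y ≤ deg G x + K * j ∧ deg G x ≤ deg G y + K * j := by
  cases j with
  | zero =>
    have := (mem_ball_zero G).1 (sphere_subset_ball G x 0 hy)
    subst this; simp
  | succ i =>
    have := abs_le.1 (h1 x (i + 1) (by omega) y hy)
    zify
    push_cast at *
    constructor <;> linarith

lemma sphere_card [Finite V] {K : ℕ} (h1 : P1 K G) (x : V) {L : ℕ} (hL : K * L ≤ deg G x) :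
    ∀ j, j ≤ L + 1 → (sphere G x j).ncard ≤ (2 * deg G x) ^ j := by
  classical
  have := Fintype.ofFinite V
  intro j
  induction j with
  | zero =>
    intro _
    have : sphere G x 0 ⊆ {x} := by
      intro y hy
      exact (mem_ball_zero G).1 (sphere_subset_ball G x 0 hy)
    simpa using Set.ncard_le_ncard this
  | succ j ih =>
    intro hj
    have ih := ih (by omega)
    have hsub : (sphere G x (j + 1)).toFinset ⊆
        (sphere G x j).toFinset.biUnion (fun w => (G.neighborSet w).toFinset) := by
      intro y hy
      rw [Set.mem_toFinset] at hy
      obtain ⟨w, hw, ha⟩ := exists_pred G hy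
      simp only [Finset.mem_biUnion, Set.mem_toFinset]
      exact ⟨w, hw, ha⟩
    rw [Set.ncard_eq_toFinset_card'] at *
    refine (Finset.card_le_card hsub).trans ?_
    refine (Finset.card_biUnion_le_card_mul _ _ (2 * deg G x) ?_).trans ?_
    · intro w hw
      rw [Set.mem_toFinset] at hw
      have := (deg_le_of_P1 G h1 hw).1
      have hKj : K * j ≤ K * L := Nat.mul_le_mul_left _ (by omega)
      rw [← Set.ncard_eq_toFinset_card']
      change deg G w ≤ _
      omega
    · rw [pow_succ]
      exact Nat.mul_le_mul_right _ ih

lemma step_count [Finite V] {K : ℕ} (h1 : P1 K G) (h2 : P2 K G) {x : V} {D : Set V}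
    (h3 : P3At K G x D) (j i : ℕ) (hn : 10 * (K * j) + 4 ≤ deg G x) (A : Set V) :
    deg G x * ((sphere G x j \ D) \ bootIter G A (i + 1)).ncard
      ≤ 4 * K * (j + 1) * ((sphere G x (j + 1) \ D) \ bootIter G A i).ncard := by
  classical
  have := Fintype.ofFinite V
  set W := (sphere G x j \ D) \ bootIter G A (i + 1) with hW
  set W' := (sphere G x (j + 1) \ D) \ bootIter G A i with hW'
  have main : ∀ w ∈ W, deg G x ≤ 4 * (G.neighborSet w ∩ W').ncard := by
    rintro w ⟨⟨hws, hwD⟩, hwA⟩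
    have hlt : ((G.neighborSet w ∩ bootIter G A i).ncard : ℝ) < (deg G w : ℝ) / 2 := by
      by_contra hcon
      exact hwA (Or.inr (not_lt.1 hcon))
    have hlt' : 2 * (G.neighborSet w ∩ bootIter G A i).ncard < deg G w := by
      have : (2 : ℝ) * ((G.neighborSet w ∩ bootIter G A i).ncard : ℝ) < (deg G w : ℝ) := by
        linarith
      exact_mod_cast this
    have hcov : G.neighborSet w ⊆ (((G.neighborSet w ∩ bootIter G A i) ∪
        (G.neighborSet w ∩ ball G x j)) ∪ (D ∩ G.neighborSet w)) ∪ (G.neighborSet w ∩ W') := by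
      intro z hz
      by_cases ha : z ∈ bootIter G A i
      · exact Or.inl (Or.inl (Or.inl ⟨hz, ha⟩))
      by_cases hb : z ∈ ball G x j
      · exact Or.inl (Or.inl (Or.inr ⟨hz, hb⟩))
      by_cases hd : z ∈ D
      · exact Or.inl (Or.inr ⟨hd, hz⟩)
      refine Or.inr ⟨hz, ⟨?_, hd⟩, ha⟩
      exact mem_sphere_of_ball G
        (mem_ball_succ_of_adj G (sphere_subset_ball G x j hws) hz) hb
    have hcard := Set.ncard_le_ncard hcov
    have u1 := Set.ncard_union_le (((G.neighborSet w ∩ bootIter G A i) ∪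
        (G.neighborSet w ∩ ball G x j)) ∪ (D ∩ G.neighborSet w)) (G.neighborSet w ∩ W')
    have u2 := Set.ncard_union_le ((G.neighborSet w ∩ bootIter G A i) ∪
        (G.neighborSet w ∩ ball G x j)) (D ∩ G.neighborSet w)
    have u3 := Set.ncard_union_le (G.neighborSet w ∩ bootIter G A i)
        (G.neighborSet w ∩ ball G x j)
    have hb : (G.neighborSet w ∩ ball G x j).ncard ≤ K * j := by
      cases j with
      | zero =>
        have hwx := (mem_ball_zero G).1 (sphere_subset_ball G x 0 hws)
        have : G.neighborSet w ∩ ball G x 0 = ∅ := by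
          ext z
          simp only [Set.mem_inter_iff, SimpleGraph.mem_neighborSet, mem_ball_zero,
            Set.mem_empty_iff_false, iff_false, not_and]
          rintro ha rfl
          rw [hwx] at ha
          exact G.loopless.irrefl _ ha
        simp [this]
      | succ j => exact h2 x (j + 1) (by omega) w hws
    have hd : (D ∩ G.neighborSet w).ncard ≤ K * j + 1 := by
      cases j with
      | zero =>
        have hwx := (mem_ball_zero G).1 (sphere_subset_ball G x 0 hws)
        have h := (h3.2 1 le_rfl).1
        simp only [Nat.sub_self, pow_zero, mul_one] at h
        refine le_trans (Set.ncard_le_ncard ?_) (h.trans (by omega))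
        rintro z ⟨hz1, hz2⟩
        refine ⟨hz1, ?_⟩
        rw [adj_mem_sphere_one, ← hwx]; exact hz2
      | succ j => exact ((h3.2 (j + 1) (by omega)).2.1 w ⟨hws, hwD⟩).trans (by omega)
    have hdeg := (deg_le_of_P1 G h1 hws).2
    have : deg G w ≤ _ := hcard
    omega
  have back : ∀ z ∈ W', (G.neighborSet z ∩ W).ncard ≤ K * (j + 1) := by
    rintro z ⟨⟨hz, _⟩, _⟩
    refine le_trans (Set.ncard_le_ncard ?_) (h2 x (j + 1) (by omega) z hz)
    rintro u ⟨hu1, ⟨hu2, _⟩, _⟩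
    exact ⟨hu1, ball_mono G x (Nat.le_succ j) (sphere_subset_ball G x j hu2)⟩
  have dc := Finset.card_mul_le_card_mul (s := W.toFinset) (t := W'.toFinset) (G.Adj)
    (m := (deg G x + 3) / 4) (n := K * (j + 1)) (by
      intro w hw
      rw [Set.mem_toFinset] at hw
      have h := main w hw
      have e : (G.neighborSet w ∩ W').ncard = #(W'.toFinset.bipartiteAbove G.Adj w) := by
        rw [← Set.ncard_coe_finset]; congr 1; ext z
        simp [Finset.bipartiteAbove, and_comm]
      rw [← e]; omega) (by
      intro z hz
      rw [Set.mem_toFinset] at hz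
      have h := back z hz
      have e : (G.neighborSet z ∩ W).ncard = #(W.toFinset.bipartiteBelow G.Adj z) := by
        rw [← Set.ncard_coe_finset]; congr 1; ext u
        simp [Finset.bipartiteBelow, and_comm, G.adj_comm]
      rw [← e]; exact h)
  rw [← Set.ncard_eq_toFinset_card', ← Set.ncard_eq_toFinset_card'] at dc
  have h4 : deg G x ≤ 4 * ((deg G x + 3) / 4) := by omega
  calc deg G x * W.ncard ≤ 4 * ((deg G x + 3) / 4) * W.ncard := Nat.mul_le_mul_right _ h4
    _ = 4 * (W.ncard * ((deg G x + 3) / 4)) := by ring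
    _ ≤ 4 * (W'.ncard * (K * (j + 1))) := Nat.mul_le_mul_left _ dc
    _ = _ := by ring

lemma many_bad [Finite V] {K : ℕ} (h1 : P1 K G) (h2 : P2 K G) {x : V} {D : Set V}
    (h3 : P3At K G x D) (k ℓ : ℕ) (hn : 10 * (K * ℓ) + 4 ≤ deg G x) (A : Set V)
    (hx : x ∉ bootIter G A (k + ℓ)) :
    (deg G x) ^ ℓ ≤ (4 * K * ℓ) ^ ℓ * ((sphere G x ℓ \ D) \ bootIter G A k).ncard := by
  have key : ∀ j, j ≤ ℓ → (deg G x) ^ j ≤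
      (4 * K * ℓ) ^ j * ((sphere G x j \ D) \ bootIter G A (k + (ℓ - j))).ncard := by
    intro j
    induction j with
    | zero =>
      intro _
      have : x ∈ (sphere G x 0 \ D) \ bootIter G A (k + (ℓ - 0)) :=
        ⟨⟨self_mem_sphere G x, h3.1⟩, hx⟩
      have := (Set.ncard_pos (Set.toFinite _)).2 ⟨x, this⟩
      simp only [pow_zero, one_mul]; omega
    | succ j ih =>
      intro hj
      have ih := ih (by omega)
      have hs : k + (ℓ - j) = (k + (ℓ - (j + 1))) + 1 := by omega
      rw [hs] at ih
      have hKj : K * j ≤ K * ℓ := Nat.mul_le_mul_left _ (by omega)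
      have st := step_count G h1 h2 h3 j (k + (ℓ - (j + 1))) (by omega) A
      set w := ((sphere G x j \ D) \ bootIter G A (k + (ℓ - (j + 1)) + 1)).ncard
      set w' := ((sphere G x (j + 1) \ D) \ bootIter G A (k + (ℓ - (j + 1)))).ncard
      calc deg G x ^ (j + 1) = deg G x ^ j * deg G x := pow_succ _ _
        _ ≤ ((4 * K * ℓ) ^ j * w) * deg G x := Nat.mul_le_mul_right _ ih
        _ = (4 * K * ℓ) ^ j * (deg G x * w) := by ring
        _ ≤ (4 * K * ℓ) ^ j * (4 * K * (j + 1) * w') := Nat.mul_le_mul_left _ st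
        _ ≤ (4 * K * ℓ) ^ j * (4 * K * ℓ * w') := by gcongr
        _ = _ := by ring
  simpa using key ℓ le_rfl

lemma exists_sep {α : Type*} [DecidableEq α] (r : α → α → Prop) [DecidableRel r]
    (hs : ∀ a b, r a b → r b a) (hr : ∀ a, r a a) (M : ℕ) :
    ∀ (N : ℕ) (W : Finset α), #W ≤ N → (∀ y ∈ W, #(W.filter (r y)) ≤ M) →
      ∃ T ⊆ W, (∀ a ∈ T, ∀ b ∈ T, a ≠ b → ¬ r a b) ∧ #W ≤ #T * M := by
  intro N
  induction N with
  | zero =>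
    intro W hW _
    exact ⟨∅, by simp, by simp, by omega⟩
  | succ N ih =>
    intro W hW hM
    by_cases he : W = ∅
    · exact ⟨∅, by simp, by simp, by simp [he]⟩
    obtain ⟨y, hy⟩ := Finset.nonempty_iff_ne_empty.2 he
    have hsplit := Finset.card_filter_add_card_filter_not (s := W) (r y)
    have hpos : 0 < #(W.filter (r y)) := Finset.card_pos.2 ⟨y, by simp [hy, hr]⟩
    obtain ⟨T, hT1, hT2, hT3⟩ := ih (W.filter (fun z => ¬ r y z)) (by omega) (by
      intro z hz
      refine le_trans (Finset.card_le_card ?_) (hM z (Finset.mem_filter.1 hz).1)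
      exact Finset.filter_subset_filter _ (Finset.filter_subset _ _))
    have hyT : y ∉ T := fun h => (Finset.mem_filter.1 (hT1 h)).2 (hr y)
    refine ⟨insert y T, ?_, ?_, ?_⟩
    · intro z hz
      rcases Finset.mem_insert.1 hz with rfl | hz
      · exact hy
      · exact (Finset.mem_filter.1 (hT1 hz)).1
    · intro a ha b hb hab
      rcases Finset.mem_insert.1 ha with rfl | ha' <;> rcases Finset.mem_insert.1 hb with rfl | hb'
      · exact absurd rfl hab
      · exact (Finset.mem_filter.1 (hT1 hb')).2
      · exact fun h => (Finset.mem_filter.1 (hT1 ha')).2 (hs _ _ h)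
      · exact hT2 a ha' b hb' hab
    · rw [Finset.card_insert_of_notMem hyT]
      have := hM y hy
      rw [add_mul, one_mul]
      omega

lemma ball_symm {a b : V} {m : ℕ} (h : b ∈ ball G a m) : a ∈ ball G b m := by
  unfold ball at *
  simp only [Set.mem_ofPred_eq] at *
  rwa [G.edist_comm]

/-- The amplification step. -/
lemma amplify [Finite V] {K : ℕ} (h1 : P1 K G) (h2 : P2 K G) (h3 : P3 K G) {p : ℝ}
    (hp0 : 0 ≤ p) (hp1 : p ≤ 1) (x : V) (k ℓ : ℕ) (hk : k < ℓ)
    (hn : 10 * (K * ℓ) + 4 ≤ deg G x) (q : ℝ)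
    (hq : ∀ y ∈ ball G x ℓ, prob p (fun A => y ∉ bootIter G A k) ≤ q) :
    prob p (fun A => x ∉ bootIter G A (k + ℓ)) ≤
      ((2 * (deg G x : ℝ)) ^ ℓ * q) ^ (deg G x / ((4 * K * ℓ) ^ ℓ * (ℓ * K ^ (ℓ - 1)))) := by
  classical
  have := Fintype.ofFinite V
  obtain ⟨D, hD⟩ := h3 x
  set n := deg G x with hndef
  set C := (4 * K * ℓ) ^ ℓ * (ℓ * K ^ (ℓ - 1)) with hC
  set b := n / C with hb
  have hq0 : 0 ≤ q := (prob_nonneg hp0 hp1 _).trans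
    (hq x (ball_mono G x (Nat.zero_le ℓ) ((mem_ball_zero G).2 rfl)))
  set S := (sphere G x ℓ).toFinset with hS
  set F := (S.powersetCard b).filter
    (fun T => ∀ a ∈ T, ∀ c ∈ T, a ≠ c → c ∉ ball G a (2 * ℓ - 1)) with hF
  have step1 : prob p (fun A => x ∉ bootIter G A (k + ℓ)) ≤
      prob p (fun A => ∃ T ∈ F, ∀ y ∈ T, y ∉ bootIter G A k) := by
    apply prob_mono hp0 hp1
    intro A hA
    have hm := many_bad G h1 h2 hD k ℓ hn A hA
    set W := ((sphere G x ℓ \ D) \ bootIter G A k) with hW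
    obtain ⟨T, hT1, hT2, hT3⟩ := exists_sep (fun a c => c ∈ ball G a (2 * ℓ - 1))
      (fun a c h => ball_symm G h)
      (fun a => ball_mono G a (Nat.zero_le _) ((mem_ball_zero G).2 rfl))
      (ℓ * K ^ (ℓ - 1) * n ^ (ℓ - 1)) _ W.toFinset le_rfl (by
        intro y hy
        rw [Set.mem_toFinset] at hy
        have h := (hD.2 ℓ (by omega)).2.2.2 y hy.1
        refine le_trans ?_ h
        rw [← Set.ncard_coe_finset]
        apply Set.ncard_le_ncard
        on_goal 1 => intro z hz
        on_goal 1 => simp only [Finset.coe_filter, Set.mem_toFinset, Set.mem_ofPred_eq] at hz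
        · exact ⟨hz.2, hz.1.1⟩
        · exact Set.toFinite _)
    rw [← Set.ncard_eq_toFinset_card'] at hT3
    have hnpos : 0 < n := by omega
    have hnC : n ≤ C * #T := by
      have e : n ^ ℓ = n ^ (ℓ - 1) * n := by
        rw [← pow_succ]; congr 1; omega
      have : n ^ (ℓ - 1) * n ≤ n ^ (ℓ - 1) * (C * #T) := by
        calc n ^ (ℓ - 1) * n = n ^ ℓ := e.symm
          _ ≤ (4 * K * ℓ) ^ ℓ * W.ncard := hm
          _ ≤ (4 * K * ℓ) ^ ℓ * (#T * (ℓ * K ^ (ℓ - 1) * n ^ (ℓ - 1))) :=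
            Nat.mul_le_mul_left _ hT3
          _ = _ := by rw [hC]; ring
      exact Nat.le_of_mul_le_mul_left this (by positivity)
    have hbT : b ≤ #T := Nat.div_le_of_le_mul hnC
    obtain ⟨T', hT'1, hT'2⟩ := Finset.exists_subset_card_eq hbT
    refine ⟨T', ?_, ?_⟩
    · rw [hF, Finset.mem_filter, Finset.mem_powersetCard]
      refine ⟨⟨?_, hT'2⟩, ?_⟩
      · intro z hz
        have := hT1 (hT'1 hz)
        rw [Set.mem_toFinset] at this
        rw [hS, Set.mem_toFinset]
        exact this.1.1
      · intro a ha c hc hac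
        exact hT2 a (hT'1 ha) c (hT'1 hc) hac
    · intro y hy
      have := hT1 (hT'1 hy)
      rw [Set.mem_toFinset] at this
      exact this.2
  refine step1.trans ((prob_exists hp0 hp1 F _).trans ?_)
  have step2 : ∀ T ∈ F, prob p (fun A => ∀ y ∈ T, y ∉ bootIter G A k) ≤ q ^ b := by
    intro T hT
    rw [hF, Finset.mem_filter, Finset.mem_powersetCard] at hT
    obtain ⟨⟨hTS, hTb⟩, hTs⟩ := hT
    rw [prob_forall p T (fun y => ball G y k) _ (fun y _ => boot_det G k y)
      (fun a ha c hc hac => ball_disjoint G (by omega) (hTs a ha c hc hac)), ← hTb]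
    rw [← Finset.prod_const]
    apply Finset.prod_le_prod
    · intro y _; exact prob_nonneg hp0 hp1 _
    · intro y hy
      apply hq
      have := hTS hy
      rw [hS, Set.mem_toFinset] at this
      exact sphere_subset_ball G x ℓ this
  refine (Finset.sum_le_card_nsmul _ _ _ step2).trans ?_
  rw [nsmul_eq_mul, mul_pow]
  apply mul_le_mul_of_nonneg_right _ (by positivity)
  have hc1 : #F ≤ #S ^ b := by
    refine (Finset.card_filter_le _ _).trans ?_
    rw [Finset.card_powersetCard]
    exact Nat.choose_le_pow _ _
  have hc2 : #S ≤ (2 * n) ^ ℓ := by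
    rw [hS, ← Set.ncard_eq_toFinset_card']
    exact sphere_card G h1 x (L := ℓ) (by omega) ℓ (by omega)
  have : #F ≤ ((2 * n) ^ ℓ) ^ b := hc1.trans (Nat.pow_le_pow_left hc2 b)
  exact_mod_cast this

end GraphPart


section Analytic

open Finset

lemma central_lower (m : ℕ) : (16 : ℝ) ^ m * 1 ≤ 4 * (m + 1) * ((m.centralBinom : ℝ)) ^ 2 ∧
    (1 ≤ m → (16 : ℝ) ^ m ≤ 4 * m * ((m.centralBinom : ℝ)) ^ 2) := by
  have key : ∀ m : ℕ, 1 ≤ m → (16 : ℝ) ^ m ≤ 4 * m * ((m.centralBinom : ℝ)) ^ 2 := by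
    intro m hm
    induction m, hm using Nat.le_induction with
    | base => norm_num [Nat.centralBinom, Nat.choose]
    | succ m hm ih =>
      have h := Nat.succ_mul_centralBinom_succ m
      have h' : ((m : ℝ) + 1) * (m + 1).centralBinom = 2 * (2 * m + 1) * m.centralBinom := by
        exact_mod_cast h
      set a : ℝ := (m.centralBinom : ℝ)
      set b : ℝ := ((m + 1).centralBinom : ℝ)
      have hm0 : (0 : ℝ) < m + 1 := by positivity
      have : ((m : ℝ) + 1) * (16 : ℝ) ^ (m + 1) ≤ (m + 1) * (4 * ((m + 1 : ℕ) : ℝ) * b ^ 2) := by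
        push_cast
        calc ((m : ℝ) + 1) * (16 : ℝ) ^ (m + 1) = 16 * (m + 1) * 16 ^ m := by rw [pow_succ]; ring
          _ ≤ 16 * (m + 1) * (4 * m * a ^ 2) := by gcongr
          _ ≤ 4 * (2 * (2 * m + 1) * a) ^ 2 := by nlinarith [sq_nonneg a]
          _ = 4 * ((m + 1) * b) ^ 2 := by rw [h']
          _ = _ := by ring
      exact le_of_mul_le_mul_left this hm0
  refine ⟨?_, key m⟩
  rcases Nat.eq_zero_or_pos m with rfl | hm
  · norm_num [Nat.centralBinom]
  · have := key m hm
    have h2 : (0 : ℝ) ≤ ((m.centralBinom : ℝ)) ^ 2 := by positivity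
    nlinarith

lemma central_lower' (m : ℕ) (hm : 1 ≤ m) :
    1 / (2 * Real.sqrt m) ≤ ((2 * m).choose m : ℝ) * (1 / 4) ^ m := by
  have h := (central_lower m).2 hm
  have hm' : (0 : ℝ) < m := by exact_mod_cast hm
  rw [div_le_iff₀ (by positivity)]
  have e : ((2 * m).choose m : ℝ) = m.centralBinom := by rw [Nat.centralBinom]
  rw [e]
  have h0 : 0 ≤ (m.centralBinom : ℝ) * (1 / 4) ^ m * (2 * Real.sqrt m) := by positivity
  have : 1 ≤ ((m.centralBinom : ℝ) * (1 / 4) ^ m * (2 * Real.sqrt m)) ^ 2 := by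
    have e2 : ((m.centralBinom : ℝ) * (1 / 4) ^ m * (2 * Real.sqrt m)) ^ 2
        = (4 * m * (m.centralBinom : ℝ) ^ 2) * (1 / 16) ^ m := by
      rw [mul_pow, mul_pow, mul_pow, Real.sq_sqrt hm'.le, ← pow_mul, mul_comm m 2, pow_mul]
      norm_num; ring
    rw [e2]
    calc (1 : ℝ) = 16 ^ m * (1 / 16) ^ m := by rw [← mul_pow]; norm_num
      _ ≤ _ := by gcongr
  nlinarith

lemma exp_le_one_sub {x : ℝ} (hx : x < 1) : Real.exp (-(x / (1 - x))) ≤ 1 - x := by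
  have h : 0 < 1 - x := by linarith
  have h1 := Real.add_one_le_exp (x / (1 - x))
  have h2 : x / (1 - x) + 1 = 1 / (1 - x) := by field_simp; ring
  rw [h2] at h1
  rw [Real.exp_neg, inv_le_comm₀ (Real.exp_pos _) h]
  simpa using h1

lemma exp_le_one_sub_two {x : ℝ} (h0 : 0 ≤ x) (hx : x ≤ 1 / 2) :
    Real.exp (-(2 * x)) ≤ 1 - x := by
  refine le_trans (Real.exp_le_exp.2 ?_) (exp_le_one_sub (by linarith))
  have : x / (1 - x) ≤ 2 * x := by
    rw [div_le_iff₀ (by linarith)]; nlinarith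
  linarith

lemma exp_le_one_sub_sq {x : ℝ} (h0 : 0 ≤ x) (hx : x ≤ 1 / 2) :
    Real.exp (-(x + 2 * x ^ 2)) ≤ 1 - x := by
  refine le_trans (Real.exp_le_exp.2 ?_) (exp_le_one_sub (by linarith))
  have : x / (1 - x) ≤ x + 2 * x ^ 2 := by
    rw [div_le_iff₀ (by linarith)]; nlinarith [mul_nonneg h0 h0]
  linarith

lemma choose_ratio (m s1 : ℕ) (h : s1 ≤ m) (hm : 1 ≤ m) : ∀ s ≤ s1,
    ((2 * m).choose m : ℝ) * (((m : ℝ) - s1) / (m + s1)) ^ s ≤ (2 * m).choose (m + s) := by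
  intro s
  have hm' : (0 : ℝ) < m := by exact_mod_cast hm
  have hs1 : (s1 : ℝ) ≤ m := by exact_mod_cast h
  induction s with
  | zero => simp
  | succ s ih =>
    intro hs
    have ih := ih (by omega)
    have hr := Nat.choose_succ_right_eq (2 * m) (m + s)
    have hr' : ((2 * m).choose (m + s + 1) : ℝ) * (m + s + 1)
        = (2 * m).choose (m + s) * ((m : ℝ) - s) := by
      have : ((2 * m - (m + s) : ℕ) : ℝ) = (m : ℝ) - s := by
        rw [Nat.cast_sub (by omega)]; push_cast; ring
      rw [← this]
      exact_mod_cast hr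
    have hss : (s : ℝ) + 1 ≤ s1 := by exact_mod_cast hs
    have e : ((2 * m).choose (m + (s + 1)) : ℝ)
        = (2 * m).choose (m + s) * (((m : ℝ) - s) / (m + s + 1)) := by
      rw [← mul_div_assoc, eq_div_iff (by positivity)]
      exact hr'
    rw [e, pow_succ, ← mul_assoc]
    apply mul_le_mul ih _ _ (by positivity)
    · apply div_le_div₀ <;> linarith
    · apply div_nonneg <;> linarith

lemma binom_tail (m s0 s1 : ℕ) (δ : ℝ) (hm : 1 ≤ m) (hs : s0 ≤ s1) (hs1 : 4 * s1 ≤ m)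
    (hδ0 : 0 ≤ δ) (hδ : δ ≤ 1 / 8) :
    ((s1 : ℝ) - s0) / (2 * Real.sqrt m) *
        Real.exp (-(4 * (s1 : ℝ) ^ 2 / m + 8 * δ * s1 + 4 * δ ^ 2 * m + 32 * δ ^ 4 * m))
      ≤ ∑ j ∈ Finset.Icc (m + s0) (m + s1),
          ((2 * m).choose j : ℝ) * ((1 / 2 - δ) ^ j * (1 - (1 / 2 - δ)) ^ (2 * m - j)) := by
  have hm' : (0 : ℝ) < m := by exact_mod_cast hm
  have hs1' : 4 * (s1 : ℝ) ≤ m := by exact_mod_cast hs1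
  have hs1'' : (0 : ℝ) ≤ s1 := by positivity
  set T := 1 / (2 * Real.sqrt m) *
      Real.exp (-(4 * (s1 : ℝ) ^ 2 / m + 8 * δ * s1 + 4 * δ ^ 2 * m + 32 * δ ^ 4 * m)) with hT
  have hT0 : 0 ≤ T := by positivity
  have term : ∀ j ∈ Finset.Icc (m + s0) (m + s1),
      T ≤ ((2 * m).choose j : ℝ) * ((1 / 2 - δ) ^ j * (1 - (1 / 2 - δ)) ^ (2 * m - j)) := by
    intro j hj
    rw [Finset.mem_Icc] at hj
    obtain ⟨s, rfl⟩ : ∃ s, j = m + s := ⟨j - m, by omega⟩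
    have hss : s ≤ s1 := by omega
    have hc := choose_ratio m s1 (by omega) hm s hss
    set ρ := ((m : ℝ) - s1) / (m + s1) with hρ
    set τ := (1 / 2 - δ) / (1 / 2 + δ) with hτ
    have hρ0 : Real.exp (-(2 * (2 * s1 / m))) ≤ ρ := by
      refine le_trans (exp_le_one_sub_two (by positivity) ?_) ?_
      · rw [div_le_iff₀ hm']; linarith
      · rw [hρ, le_div_iff₀ (by positivity)]
        have : 2 * (s1 : ℝ) / m * m = 2 * s1 := by field_simp
        have h2 : 0 ≤ 2 * (s1 : ℝ) / m * s1 := by positivity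
        nlinarith
    have hρ1 : ρ ≤ 1 := by rw [hρ, div_le_one (by positivity)]; linarith
    have hτ0 : Real.exp (-(2 * (4 * δ))) ≤ τ := by
      refine le_trans (exp_le_one_sub_two (by positivity) (by linarith)) ?_
      rw [hτ, le_div_iff₀ (by positivity)]
      nlinarith
    have hτ1 : τ ≤ 1 := by rw [hτ, div_le_one (by positivity)]; linarith
    have a1 : Real.exp (-(4 * (s1 : ℝ) ^ 2 / m)) ≤ ρ ^ s := by
      calc Real.exp (-(4 * (s1 : ℝ) ^ 2 / m)) = Real.exp (-(2 * (2 * s1 / m))) ^ s1 := by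
            rw [← Real.exp_nat_mul]; congr 1; ring
        _ ≤ ρ ^ s1 := by gcongr
        _ ≤ ρ ^ s := pow_le_pow_of_le_one ((Real.exp_pos _).le.trans hρ0) hρ1 hss
    have a2 : Real.exp (-(8 * δ * s1)) ≤ τ ^ s := by
      calc Real.exp (-(8 * δ * s1)) = Real.exp (-(2 * (4 * δ))) ^ s1 := by
            rw [← Real.exp_nat_mul]; congr 1; ring
        _ ≤ τ ^ s1 := by gcongr
        _ ≤ τ ^ s := pow_le_pow_of_le_one ((Real.exp_pos _).le.trans hτ0) hτ1 hss
    have a3 : Real.exp (-(4 * δ ^ 2 * m + 32 * δ ^ 4 * m)) ≤ (1 - 4 * δ ^ 2) ^ m := by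
      calc Real.exp (-(4 * δ ^ 2 * m + 32 * δ ^ 4 * m))
          = Real.exp (-(4 * δ ^ 2 + 2 * (4 * δ ^ 2) ^ 2)) ^ m := by
            rw [← Real.exp_nat_mul]; congr 1; ring
        _ ≤ _ := by
          gcongr
          apply exp_le_one_sub_sq (by positivity)
          nlinarith
    have e : (1 / 2 - δ) ^ (m + s) * (1 - (1 / 2 - δ)) ^ (2 * m - (m + s))
        = (1 / 4) ^ m * (1 - 4 * δ ^ 2) ^ m * τ ^ s := by
      have hk : 2 * m - (m + s) = m - s := by omega
      have h5 : (1 / 2 + δ) ^ (m - s) * (1 / 2 + δ) ^ s = (1 / 2 + δ) ^ m := by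
        rw [← pow_add]; congr 1; omega
      have h6 : (1 / 2 + δ) ^ s ≠ 0 := by positivity
      have h7 : (1 - (1 / 2 - δ)) = 1 / 2 + δ := by ring
      have h8 : (1 / 4 : ℝ) ^ m * (1 - 4 * δ ^ 2) ^ m = (1 / 2 - δ) ^ m * (1 / 2 + δ) ^ m := by
        rw [← mul_pow, ← mul_pow]; congr 1; ring
      rw [hk, h7, h8, hτ, div_pow, pow_add, ← h5]
      field_simp
    rw [e]
    have hcl := central_lower' m hm
    calc T = 1 / (2 * Real.sqrt m) * Real.exp (-(4 * (s1 : ℝ) ^ 2 / m)) *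
          Real.exp (-(8 * δ * s1)) * Real.exp (-(4 * δ ^ 2 * m + 32 * δ ^ 4 * m)) := by
          have e9 : Real.exp (-(4 * (s1 : ℝ) ^ 2 / m + 8 * δ * s1 + 4 * δ ^ 2 * m
              + 32 * δ ^ 4 * m)) = Real.exp (-(4 * (s1 : ℝ) ^ 2 / m)) *
              Real.exp (-(8 * δ * s1)) * Real.exp (-(4 * δ ^ 2 * m + 32 * δ ^ 4 * m)) := by
            rw [← Real.exp_add, ← Real.exp_add]; congr 1; ring
          rw [hT, e9]; ring
      _ ≤ (((2 * m).choose m : ℝ) * (1 / 4) ^ m) * ρ ^ s * τ ^ s * (1 - 4 * δ ^ 2) ^ m := by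
          have := (Real.exp_pos _).le.trans a1
          have := (Real.exp_pos _).le.trans a2
          gcongr
      _ = (((2 * m).choose m : ℝ) * ρ ^ s) * ((1 / 4) ^ m * (1 - 4 * δ ^ 2) ^ m * τ ^ s) := by
          ring
      _ ≤ _ := by
          apply mul_le_mul_of_nonneg_right hc
          have h1 := (Real.exp_pos _).le.trans a2
          have h2 := (Real.exp_pos _).le.trans a3
          positivity
  have hsum := Finset.card_nsmul_le_sum _ _ _ term
  rw [nsmul_eq_mul, Nat.card_Icc] at hsum
  refine le_trans ?_ hsum
  have hcast : ((m + s1 + 1 - (m + s0) : ℕ) : ℝ) = (s1 : ℝ) - s0 + 1 := by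
    rw [Nat.cast_sub (by omega)]; push_cast; ring
  rw [hcast]
  have : ((s1 : ℝ) - s0) / (2 * Real.sqrt m) *
        Real.exp (-(4 * (s1 : ℝ) ^ 2 / m + 8 * δ * s1 + 4 * δ ^ 2 * m + 32 * δ ^ 4 * m))
        = ((s1 : ℝ) - s0) * T := by rw [hT]; ring
  rw [this]
  nlinarith

lemma chernoff_factor {δ l : ℝ} (hδ0 : 0 ≤ δ) (hδ : δ ≤ 1 / 2) (hl0 : 0 ≤ l) (hl1 : l ≤ 1) :
    (1 / 2 - δ) * Real.exp (-l) + (1 - (1 / 2 - δ))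
      ≤ Real.exp (-(l / 2) + l ^ 2 / 4 + l * δ) := by
  have b : ∀ y : ℝ, |y| ≤ 1 → Real.exp y ≤ 1 + y + y ^ 2 := by
    intro y hy
    have := Real.abs_exp_sub_one_sub_id_le hy
    have := (abs_le.1 this).2
    linarith
  have b1 := b (l / 2) (by rw [abs_of_nonneg (by positivity)]; linarith)
  have b2 := b (-(l / 2)) (by rw [abs_neg, abs_of_nonneg (by positivity)]; linarith)
  have e1 : Real.exp (-l) = Real.exp (-(l / 2)) * Real.exp (-(l / 2)) := by
    rw [← Real.exp_add]; congr 1; ring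
  have e2 : (1 : ℝ) = Real.exp (-(l / 2)) * Real.exp (l / 2) := by
    rw [← Real.exp_add]; simp
  have e3 : Real.exp (-(l / 2) + l ^ 2 / 4 + l * δ)
      = Real.exp (-(l / 2)) * Real.exp (l ^ 2 / 4 + l * δ) := by
    rw [← Real.exp_add]; congr 1; ring
  have e4 : (1 / 2 - δ) * Real.exp (-l) + (1 - (1 / 2 - δ))
      = Real.exp (-(l / 2)) * ((1 / 2 - δ) * Real.exp (-(l / 2))
        + (1 / 2 + δ) * Real.exp (l / 2)) := by
    rw [e1]
    linear_combination (1 / 2 + δ) * e2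
  rw [e3, e4]
  apply mul_le_mul_of_nonneg_left _ (Real.exp_pos _).le
  have := Real.add_one_le_exp (l ^ 2 / 4 + l * δ)
  have c1 : (1 / 2 - δ) * Real.exp (-(l / 2)) ≤ (1 / 2 - δ) * (1 + -(l / 2) + (-(l / 2)) ^ 2) :=
    mul_le_mul_of_nonneg_left b2 (by linarith)
  have c2 : (1 / 2 + δ) * Real.exp (l / 2) ≤ (1 / 2 + δ) * (1 + l / 2 + (l / 2) ^ 2) :=
    mul_le_mul_of_nonneg_left b1 (by linarith)
  nlinarith

end Analytic


section TwoStep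

open Finset

variable {V : Type} (G : SimpleGraph V)

lemma two_step [Finite V] {K : ℕ} (h2 : P2 K G) (h3 : P3 K G) {p : ℝ}
    (hp0 : 0 ≤ p) (hp1 : p ≤ 1) (v : V) (r k m s0 : ℕ) (μ : ℝ)
    (hkr : k * r + 1 ≤ deg G v)
    (hdeg : ∀ y, G.Adj v y → 2 * m + 2 * K + r ≤ deg G y ∧ deg G y ≤ 2 * (m + s0))
    (hμ : ∀ P : Set V, P.ncard = 2 * m →
      μ ≤ prob p (fun A => ((m + s0 : ℕ) : ℝ) ≤ ((P ∩ A).ncard : ℝ))) :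
    prob p (fun A => v ∉ bootIter G A 2) ≤
      k * (1 - (1 - p) * μ) ^ r +
        prob p (fun A => ((G.neighborSet v ∩ A).ncard : ℝ) < (deg G v : ℝ) / 2 - k) := by
  classical
  have := Fintype.ofFinite V
  obtain ⟨D, hDv, hD⟩ := h3 v
  -- the embedding
  have hS0 : k * r ≤ (G.neighborSet v \ D).ncard := by
    have h := (hD 1 le_rfl).1
    simp only [Nat.sub_self, pow_zero, mul_one] at h
    have hc : G.neighborSet v ⊆ (D ∩ sphere G v 1) ∪ (G.neighborSet v \ D) := by
      intro z hz
      by_cases hd : z ∈ D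
      · exact Or.inl ⟨hd, (adj_mem_sphere_one G).2 hz⟩
      · exact Or.inr ⟨hz, hd⟩
    have a1 := Set.ncard_le_ncard hc
    have a2 := Set.ncard_union_le (D ∩ sphere G v 1) (G.neighborSet v \ D)
    have a3 : deg G v ≤ _ := a1
    omega
  have hemb : Nonempty ((Fin k × Fin r) ↪ (G.neighborSet v \ D : Set V)) := by
    apply Function.Embedding.nonempty_of_card_le
    rw [Fintype.card_prod, Fintype.card_fin, Fintype.card_fin]
    refine hS0.trans (le_of_eq ?_)
    rw [Set.ncard_eq_toFinset_card', Set.toFinset_card]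
  obtain ⟨e⟩ := hemb
  have hadj : ∀ i, G.Adj v (e i : V) := fun i => (e i).2.1
  have heD : ∀ i, (e i : V) ∉ D := fun i => (e i).2.2
  have hinj : ∀ i j, (e i : V) = (e j : V) → i = j := fun i j h => e.injective (Subtype.ext h)
  have hs1 : ∀ i, (e i : V) ∈ sphere G v 1 := fun i => (adj_mem_sphere_one G).2 (hadj i)
  -- the private neighbourhoods
  have hQ : ∀ i : Fin k × Fin r, ∃ Q : Set V, Q ⊆ G.neighborSet (e i : V) ∧
      Q ⊆ sphere G v 2 ∧ (∀ b, b ≠ i.2 → ∀ z ∈ Q, ¬ G.Adj (e (i.1, b) : V) z) ∧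
      Q.ncard = 2 * m := by
    intro i
    set P : Set V := {z | z ∈ G.neighborSet (e i : V) ∧ z ∈ sphere G v 2 ∧
      ∀ b, b ≠ i.2 → ¬ G.Adj (e (i.1, b) : V) z} with hP
    set N := (G.neighborSet (e i : V)).toFinset with hN
    set R := (Finset.univ.filter (fun b => b ≠ i.2)).biUnion (fun b =>
      (G.neighborSet (e i : V) ∩ G.neighborSet (e (i.1, b) : V) ∩
        (sphere G v 2 \ D)).toFinset) with hR
    have hRc : #R ≤ r := by
      have h := Finset.card_biUnion_le_card_mul (Finset.univ.filter (fun b => b ≠ i.2)) (fun b =>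
        (G.neighborSet (e i : V) ∩ G.neighborSet (e (i.1, b) : V) ∩
          (sphere G v 2 \ D)).toFinset) 1 (by
          intro b hb
          rw [Finset.mem_filter] at hb
          rw [← Set.ncard_eq_toFinset_card']
          apply (hD 1 le_rfl).2.2.1 _ ⟨hs1 i, heD i⟩ _ ⟨hs1 _, heD _⟩
          intro h
          have := hinj _ _ h
          apply hb.2
          rw [this])
      refine h.trans ?_
      rw [mul_one]
      refine (Finset.card_filter_le _ _).trans ?_
      simp
    have hcov : G.neighborSet (e i : V) ⊆ (((G.neighborSet (e i : V) ∩ ball G v 1) ∪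
        (D ∩ G.neighborSet (e i : V))) ∪ (R : Set V)) ∪ P := by
      intro z hz
      by_cases hb : z ∈ ball G v 1
      · exact Or.inl (Or.inl (Or.inl ⟨hz, hb⟩))
      by_cases hd : z ∈ D
      · exact Or.inl (Or.inl (Or.inr ⟨hd, hz⟩))
      have hz2 : z ∈ sphere G v 2 := mem_sphere_of_ball G
        (mem_ball_succ_of_adj G (sphere_subset_ball G v 1 (hs1 i)) hz) hb
      by_cases hr : z ∈ R
      · exact Or.inl (Or.inr hr)
      refine Or.inr ⟨hz, hz2, ?_⟩
      intro b hb ha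
      apply hr
      rw [hR, Finset.mem_biUnion]
      refine ⟨b, by simp [hb], ?_⟩
      rw [Set.mem_toFinset]
      exact ⟨⟨hz, ha⟩, hz2, hd⟩
    have a1 := Set.ncard_le_ncard hcov
    have a2 := Set.ncard_union_le (((G.neighborSet (e i : V) ∩ ball G v 1) ∪
        (D ∩ G.neighborSet (e i : V))) ∪ (R : Set V)) P
    have a3 := Set.ncard_union_le ((G.neighborSet (e i : V) ∩ ball G v 1) ∪
        (D ∩ G.neighborSet (e i : V))) (R : Set V)
    have a4 := Set.ncard_union_le (G.neighborSet (e i : V) ∩ ball G v 1)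
        (D ∩ G.neighborSet (e i : V))
    have a5 := h2 v 1 le_rfl _ (hs1 i)
    have a6 := (hD 1 le_rfl).2.1 _ ⟨hs1 i, heD i⟩
    rw [Set.ncard_coe_finset] at a3
    have a7 := (hdeg _ (hadj i)).1
    have a8 : deg G (e i : V) ≤ _ := a1
    have hPc : 2 * m ≤ P.ncard := by omega
    obtain ⟨Q, hQ1, hQ2⟩ := Set.exists_subset_card_eq hPc
    refine ⟨Q, fun z hz => (hQ1 hz).1, fun z hz => (hQ1 hz).2.1, ?_, hQ2⟩
    intro b hb z hz
    exact (hQ1 hz).2.2 b hb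
  choose Q hQN hQS hQp hQc using hQ
  let E : Fin k × Fin r → Set V → Prop := fun i A =>
    (e i : V) ∉ A ∧ ((m + s0 : ℕ) : ℝ) ≤ ((Q i ∩ A).ncard : ℝ)
  have hnot2 : ∀ i j, (e i : V) ∉ Q j := by
    intro i j h
    exact not_mem_ball_of_sphere G (hQS j h) (sphere_subset_ball G v 1 (hs1 i))
  have hdet1 : ∀ i, Det {(e i : V)} (fun A => (e i : V) ∉ A) := by
    intro i A B h
    have := Set.ext_iff.1 h (e i : V)
    simp only [Set.mem_inter_iff, Set.mem_singleton_iff, and_true] at this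
    exact not_congr this
  have hdet2 : ∀ i, Det (Q i) (fun A => ((m + s0 : ℕ) : ℝ) ≤ ((Q i ∩ A).ncard : ℝ)) := by
    intro i A B h
    simp only [Set.inter_comm (Q i), h]
  have hEprob : ∀ i, (1 - p) * μ ≤ prob p (E i) := by
    intro i
    have h := prob_and p (U := {(e i : V)}) (W := Q i) (by
      rw [Set.disjoint_singleton_left]; exact hnot2 i i) (hdet1 i) (hdet2 i)
    rw [prob_notMem] at h
    refine le_trans ?_ (le_of_eq h.symm)
    exact mul_le_mul_of_nonneg_left (hμ _ (hQc i)) (by linarith)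
  have hEdet : ∀ i, Det ({(e i : V)} ∪ Q i) (fun A => ¬ E i A) := by
    intro i A B h
    apply not_congr
    apply and_congr
    · apply hdet1 i A B
      rw [Set.inter_union_distrib_left, Set.inter_union_distrib_left] at h
      ext z
      simp only [Set.mem_inter_iff, Set.mem_singleton_iff]
      constructor
      · rintro ⟨hz, rfl⟩
        have := (Set.ext_iff.1 h (e i : V)).1 (Or.inl ⟨hz, rfl⟩)
        rcases this with h' | h'
        · exact h'
        · exact ⟨h'.1, rfl⟩
      · rintro ⟨hz, rfl⟩
        have := (Set.ext_iff.1 h (e i : V)).2 (Or.inl ⟨hz, rfl⟩)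
        rcases this with h' | h'
        · exact h'
        · exact ⟨h'.1, rfl⟩
    · apply hdet2 i A B
      ext z
      have := Set.ext_iff.1 h z
      simp only [Set.mem_inter_iff, Set.mem_union] at *
      tauto
  have hgroup : ∀ a : Fin k, prob p (fun A => ∀ b ∈ (Finset.univ : Finset (Fin r)), ¬ E (a, b) A)
      ≤ (1 - (1 - p) * μ) ^ r := by
    intro a
    rw [prob_forall p Finset.univ (fun b => {(e (a, b) : V)} ∪ Q (a, b)) (fun b A => ¬ E (a, b) A)
      (fun b _ => hEdet (a, b))]
    · have : ∀ b ∈ (Finset.univ : Finset (Fin r)), prob p (fun A => ¬ E (a, b) A)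
          ≤ 1 - (1 - p) * μ := by
        intro b _
        rw [prob_not]
        linarith [hEprob (a, b)]
      refine (Finset.prod_le_prod (fun b _ => prob_nonneg hp0 hp1 _) this).trans ?_
      rw [Finset.prod_const, Finset.card_univ, Fintype.card_fin]
    · intro b _ b' _ hbb
      rw [Set.disjoint_left]
      rintro z (hz | hz) (hz' | hz')
      · rw [Set.mem_singleton_iff] at hz hz'
        rw [hz] at hz'
        have := hinj _ _ hz'
        simp only [Prod.mk.injEq, true_and] at this
        exact hbb this
      · rw [Set.mem_singleton_iff] at hz
        rw [hz] at hz'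
        exact hnot2 _ _ hz'
      · rw [Set.mem_singleton_iff] at hz'
        rw [hz'] at hz
        exact hnot2 _ _ hz
      · exact hQp (a, b) b' (Ne.symm hbb) z hz (hQN (a, b') hz')
  have hmain : prob p (fun A => v ∉ bootIter G A 2) ≤
      prob p (fun A => (∃ a ∈ (Finset.univ : Finset (Fin k)),
          ∀ b ∈ (Finset.univ : Finset (Fin r)), ¬ E (a, b) A) ∨
        ((G.neighborSet v ∩ A).ncard : ℝ) < (deg G v : ℝ) / 2 - k) := by
    apply prob_mono hp0 hp1
    intro A hA
    by_contra hcon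
    push Not at hcon
    obtain ⟨hg, hc⟩ := hcon
    apply hA
    have hg' : ∀ a : Fin k, ∃ b, E (a, b) A := by
      intro a
      obtain ⟨b, _, hb⟩ := hg a (Finset.mem_univ _)
      exact ⟨b, hb⟩
    choose b hb using hg'
    right
    have hy1 : ∀ a, (e (a, b a) : V) ∈ bootIter G A 1 := by
      intro a
      right
      change (deg G (e (a, b a) : V) : ℝ) / 2 ≤
        ((G.neighborSet (e (a, b a) : V) ∩ A).ncard : ℝ)
      have h1 := (hdeg _ (hadj (a, b a))).2
      have h2 := (hb a).2
      have h3 : (Q (a, b a) ∩ A).ncard ≤ (G.neighborSet (e (a, b a) : V) ∩ A).ncard :=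
        Set.ncard_le_ncard (Set.inter_subset_inter_left _ (hQN _))
      have h1' : (deg G (e (a, b a) : V) : ℝ) ≤ 2 * ((m + s0 : ℕ) : ℝ) := by exact_mod_cast h1
      have h3' : ((Q (a, b a) ∩ A).ncard : ℝ) ≤
        ((G.neighborSet (e (a, b a) : V) ∩ A).ncard : ℝ) := by exact_mod_cast h3
      linarith
    set Y : Finset V := Finset.univ.image (fun a : Fin k => (e (a, b a) : V)) with hY
    have hYc : #Y = k := by
      rw [hY, Finset.card_image_of_injective, Finset.card_univ, Fintype.card_fin]
      intro a a' h
      have := hinj _ _ h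
      exact (Prod.mk.inj this).1
    have hYd : Disjoint (G.neighborSet v ∩ A) (Y : Set V) := by
      rw [Set.disjoint_left]
      rintro z ⟨_, hzA⟩ hzY
      rw [hY, Finset.mem_coe, Finset.mem_image] at hzY
      obtain ⟨a, _, rfl⟩ := hzY
      exact (hb a).1 hzA
    have hsub : (G.neighborSet v ∩ A) ∪ (Y : Set V) ⊆ G.neighborSet v ∩ bootIter G A 1 := by
      rintro z (⟨hz1, hz2⟩ | hz)
      · exact ⟨hz1, Or.inl hz2⟩
      · rw [hY, Finset.mem_coe, Finset.mem_image] at hz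
        obtain ⟨a, _, rfl⟩ := hz
        exact ⟨hadj _, hy1 a⟩
    have hcard := Set.ncard_le_ncard hsub
    rw [Set.ncard_union_eq hYd, Set.ncard_coe_finset, hYc] at hcard
    have hcard' : ((G.neighborSet v ∩ A).ncard : ℝ) + k ≤
      ((G.neighborSet v ∩ bootIter G A 1).ncard : ℝ) := by exact_mod_cast hcard
    change (deg G v : ℝ) / 2 ≤ ((G.neighborSet v ∩ bootIter G A 1).ncard : ℝ)
    linarith
  refine hmain.trans ((prob_or hp0 hp1 _ _).trans ?_)
  apply add_le_add_left
  refine (prob_exists hp0 hp1 Finset.univ _).trans ?_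
  refine (Finset.sum_le_card_nsmul _ _ _ (fun a _ => hgroup a)).trans ?_
  rw [Finset.card_univ, Fintype.card_fin, nsmul_eq_mul]

end TwoStep


section Params

lemma eventual_facts {ε : ℝ} (hε : 0 < ε) : ∀ᶠ d : ℕ in atTop,
    1 ≤ Real.log d ∧ 24 * Real.sqrt (Real.log d) + 146 ≤ ε * Real.log d ∧
    (Real.log d) ^ 2 ≤ d ∧ 16 * Real.log d ≤ d ∧
    6 * Real.log d + 2 ≤ Real.exp (ε * Real.log d) / 8 := by
  have hlog : Tendsto (fun d : ℕ => Real.log (d : ℝ)) atTop atTop :=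
    Real.tendsto_log_atTop.comp tendsto_natCast_atTop_atTop
  have bd : ∀ r C : ℝ, 0 < r → 0 < C → ∀ᶠ d : ℕ in atTop, Real.log d ≤ C * (d : ℝ) ^ r := by
    intro r C hr hC
    have h := (isLittleO_log_rpow_atTop hr).bound hC
    have h' := tendsto_natCast_atTop_atTop (R := ℝ) |>.eventually h
    filter_upwards [h', eventually_ge_atTop 1] with d hd hd1
    have hd0 : (1 : ℝ) ≤ d := by exact_mod_cast hd1
    rw [Real.norm_of_nonneg (Real.log_nonneg hd0),
      Real.norm_of_nonneg (Real.rpow_nonneg (by linarith) _)] at hd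
    exact hd
  filter_upwards [hlog.eventually_ge_atTop 1, hlog.eventually_ge_atTop ((170 / ε) ^ 2),
    bd (1 / 2) 1 (by norm_num) one_pos, bd 1 (1 / 16) one_pos (by norm_num),
    bd ε (1 / 64) hε (by norm_num), eventually_ge_atTop 1] with d h1 h2 h3 h4 h5 h6
  have hd0 : (0 : ℝ) < d := by exact_mod_cast h6
  refine ⟨h1, ?_, ?_, ?_, ?_⟩
  · set u := Real.sqrt (Real.log d) with hu
    have hu2 : u ^ 2 = Real.log d := Real.sq_sqrt (by linarith)
    have hu1 : 1 ≤ u := by rw [hu]; exact Real.one_le_sqrt.2 h1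
    have hu3 : 170 / ε ≤ u := by rw [hu]; exact Real.le_sqrt_of_sq_le h2
    rw [div_le_iff₀ hε] at hu3
    rw [← hu2]
    nlinarith
  · rw [one_mul] at h3
    have h0 : 0 ≤ Real.log d := by linarith
    calc (Real.log d) ^ 2 ≤ ((d : ℝ) ^ (1 / 2 : ℝ)) ^ 2 := by gcongr
      _ = (d : ℝ) := by
        rw [← Real.rpow_natCast, ← Real.rpow_mul hd0.le]; norm_num
  · rw [Real.rpow_one] at h4; linarith
  · have : (d : ℝ) ^ ε = Real.exp (ε * Real.log d) := by
      rw [Real.rpow_def_of_pos hd0, mul_comm]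
    rw [this] at h5
    linarith

set_option maxHeartbeats 4000000 in
lemma params (K : ℕ) (c : ℝ) (hc0 : 0 < c) (hc : c < 1 / 2) : ∃ N : ℕ, ∀ d : ℕ, N ≤ d →
    ∃ (r k m s0 s1 : ℕ) (μ : ℝ), 
      0 ≤ c * Real.sqrt (Real.log d / d) ∧ c * Real.sqrt (Real.log d / d) ≤ 1 / 8 ∧
      k * r + 1 + 9 * K ≤ d ∧ 2 * m + 12 * K + r ≤ d ∧ d + 10 * K ≤ 2 * (m + s0) ∧
      s1 ≤ m ∧ 10 * K ≤ d ∧ 1 ≤ d ∧ 0 ≤ μ ∧ μ ≤ 1 ∧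
      μ ≤ ∑ j ∈ Finset.Icc (m + s0) (m + s1), ((2 * m).choose j : ℝ) *
        ((1 / 2 - c * Real.sqrt (Real.log d / d)) ^ j *
          (1 - (1 / 2 - c * Real.sqrt (Real.log d / d))) ^ (2 * m - j)) ∧
      k * Real.exp (-(μ / 2 * r)) ≤ ((d : ℝ) ^ 5)⁻¹ / 2 ∧
      ∃ l : ℝ, 0 ≤ l ∧ l ≤ 1 ∧ Real.exp (-(l * k) + 2 * d * (l ^ 2 / 4 +
        l * (c * Real.sqrt (Real.log d / d)))) ≤ ((d : ℝ) ^ 5)⁻¹ / 2 := by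
  set ε := (1 / 2 - 2 * c ^ 2) / 4 with hε
  have hc2 : c ^ 2 < 1 / 4 := by nlinarith
  have hc2' : 0 < c ^ 2 := by positivity
  have hε0 : 0 < ε := by rw [hε]; linarith
  have hε1 : ε ≤ 1 / 8 := by rw [hε]; linarith
  obtain ⟨N1, hN1⟩ := eventually_atTop.1 (eventual_facts hε0)
  refine ⟨max N1 ((48 + 12 * K) ^ 2), ?_⟩
  intro d hd
  obtain ⟨f1, f2, f3, f4, f5⟩ := hN1 d (le_trans (le_max_left _ _) hd)
  have hd2 : (48 + 12 * K) ^ 2 ≤ d := le_trans (le_max_right _ _) hd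
  set L := Real.log d with hL
  set s := Real.sqrt d with hs
  set a := Real.exp (ε * L) with ha
  have hss : 48 + 12 * (K : ℝ) ≤ s := by
    apply Real.le_sqrt_of_sq_le; exact_mod_cast hd2
  have hK0 : (0 : ℝ) ≤ K := by positivity
  have hs0 : 0 < s := by linarith
  have hdpos : (0 : ℝ) < d := Real.sqrt_pos.1 hs0
  have hsd : s * s = d := Real.mul_self_sqrt hdpos.le
  have hs48 : 48 * s ≤ d := by
    rw [← hsd]; exact mul_le_mul_of_nonneg_right (by linarith) hs0.le
  have hdL : (d : ℝ) = Real.exp L := (Real.exp_log hdpos).symm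
  have hsL : s = Real.exp (L / 2) := by
    rw [hs, hdL, Real.sqrt_eq_iff_mul_self_eq (Real.exp_pos _).le (Real.exp_pos _).le,
      ← Real.exp_add]
    congr 1; ring
  have ha1 : 1 ≤ a := Real.one_le_exp (by positivity)
  have ha0 : 0 < a := by linarith
  have ha3 : a ^ 3 ≤ s := by
    rw [ha, hsL, ← Real.exp_nat_mul]
    apply Real.exp_le_exp.2
    push_cast
    have h0 : ε * L ≤ 1 / 8 * L := mul_le_mul_of_nonneg_right hε1 (by linarith)
    linarith
  have ha3' : a ≤ a ^ 3 := le_self_pow₀ ha1 (by norm_num)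
  have has : a ≤ s := ha3'.trans ha3
  set δ := c * Real.sqrt (L / d) with hδ
  have hδs : δ * s = c * Real.sqrt L := by
    rw [hδ, Real.sqrt_div (by linarith), ← hs]; field_simp
  have hδ0 : 0 ≤ δ := by positivity
  have hδ2 : δ ^ 2 * d = c ^ 2 * L := by
    have h : δ ^ 2 * d = (δ * s) ^ 2 := by rw [← hsd]; ring
    rw [h, hδs, mul_pow, Real.sq_sqrt (by linarith)]
  have hδ8 : δ ≤ 1 / 8 := by
    have h1 : δ ^ 2 * d ≤ (1 / 64) * d := by
      have h0 : c ^ 2 * L ≤ 1 / 4 * L := mul_le_mul_of_nonneg_right hc2.le (by linarith)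
      rw [hδ2]; linarith
    have h2 : δ ^ 2 ≤ 1 / 64 := le_of_mul_le_mul_right h1 hdpos
    refine abs_le_of_sq_le_sq' (by linarith) (by norm_num) |>.2
  have hsqL : Real.sqrt L ≤ L := by
    rw [Real.sqrt_le_left (by linarith)]; exact le_self_pow₀ f1 (by norm_num)
  have hsqL0 : 0 ≤ Real.sqrt L := Real.sqrt_nonneg L
  set r := ⌊s / a⌋₊ with hr
  set k := ⌊s * a / 4⌋₊ with hk
  have hr1 : (r : ℝ) ≤ s / a := Nat.floor_le (by positivity)
  have hrs : (r : ℝ) ≤ s := hr1.trans (div_le_self hs0.le ha1)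
  have hr2 : s / a / 2 ≤ r := by
    have h1 : 1 ≤ s / a := by rw [le_div_iff₀ ha0]; linarith
    have h2 := Nat.lt_floor_add_one (s / a)
    have h3 : 1 ≤ r := Nat.le_floor (by simpa using h1)
    have h4 : (1 : ℝ) ≤ r := by exact_mod_cast h3
    linarith
  have hk1 : (k : ℝ) ≤ s * a / 4 := Nat.floor_le (by positivity)
  have hk2 : s * a / 8 ≤ k := by
    have h0 : s * 1 ≤ s * a := by gcongr
    have h1 : 1 ≤ s * a / 4 := by linarith
    have h2 := Nat.lt_floor_add_one (s * a / 4)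
    have h3 : 1 ≤ k := Nat.le_floor (by simpa using h1)
    have h4 : (1 : ℝ) ≤ k := by exact_mod_cast h3
    linarith
  have hkr : (k : ℝ) * r ≤ d / 4 := by
    calc (k : ℝ) * r ≤ (s * a / 4) * (s / a) := by gcongr
      _ = s * s / 4 := by field_simp
      _ = d / 4 := by rw [hsd]
  set m := (d - (12 * K + r)) / 2 with hm
  set s0 := 11 * K + r + 1 with hs0d
  set s1 := s0 + (Nat.sqrt d + 1) with hs1d
  have hKr : 12 * K + r ≤ d := by
    have : (12 : ℝ) * K + r ≤ d := by linarith
    exact_mod_cast this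
  have hm1 : 2 * m + 12 * K + r ≤ d := by omega
  have hm2 : d ≤ 2 * m + 12 * K + r + 1 := by omega
  have hm1' : 2 * (m : ℝ) + 12 * K + r ≤ d := by exact_mod_cast hm1
  have hm2' : (d : ℝ) ≤ 2 * m + 12 * K + r + 1 := by exact_mod_cast hm2
  have hr0 : (0 : ℝ) ≤ r := by positivity
  have hmhi : (m : ℝ) ≤ d / 2 := by linarith
  have hmlo : (d : ℝ) / 4 ≤ m := by linarith
  have hmpos : (0 : ℝ) < m := by linarith [hdpos]
  have hsq1 : s ≤ (Nat.sqrt d : ℝ) + 1 := by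
    have := Nat.lt_succ_sqrt d
    rw [hs]
    apply Real.sqrt_le_iff.2
    refine ⟨by positivity, ?_⟩
    rw [pow_two]
    exact_mod_cast this.le
  have hsq2 : (Nat.sqrt d : ℝ) ≤ s := by
    rw [hs]
    apply Real.le_sqrt_of_sq_le
    exact_mod_cast Nat.sqrt_le' d
  have hs1c : (s1 : ℝ) = s0 + (Nat.sqrt d + 1) := by rw [hs1d]; push_cast; ring
  have hs0c : (s0 : ℝ) = 11 * K + r + 1 := by rw [hs0d]; push_cast; ring
  have hs13 : (s1 : ℝ) ≤ 3 * s := by rw [hs1c, hs0c]; linarith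
  have hs1m : 4 * s1 ≤ m := by
    have : 4 * (s1 : ℝ) ≤ m := by linarith
    exact_mod_cast this
  have hs1n : (0 : ℝ) ≤ s1 := by positivity
  have hd5 : ((d : ℝ) ^ 5)⁻¹ = Real.exp (-(5 * L)) := by
    rw [Real.exp_neg, hdL, ← Real.exp_nat_mul]; norm_num
  have hhalf : Real.exp (-1) ≤ 1 / 2 := by
    rw [Real.exp_neg, inv_le_comm₀ (Real.exp_pos _) (by norm_num)]
    have := Real.add_one_le_exp 1
    norm_num at this ⊢
    linarith
  have hexp : ∀ y : ℝ, y ≤ -(5 * L) - 1 → Real.exp y ≤ ((d : ℝ) ^ 5)⁻¹ / 2 := by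
    intro y hy
    calc Real.exp y ≤ Real.exp (-(5 * L) + -1) := Real.exp_le_exp.2 (by linarith)
      _ = Real.exp (-(5 * L)) * Real.exp (-1) := Real.exp_add _ _
      _ ≤ Real.exp (-(5 * L)) * (1 / 2) := by gcongr
      _ = _ := by rw [hd5]; ring
  refine ⟨r, k, m, s0, s1, a ^ 3 / s, hδ0, hδ8, ?_, hm1, by omega, by omega, ?_, ?_, by positivity,
    ?_, ?_, ?_, ?_⟩
  · have : (k : ℝ) * r + 1 + 9 * K ≤ d := by linarith
    exact_mod_cast this
  · have : (10 : ℝ) * K ≤ d := by linarith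
    exact_mod_cast this
  · exact_mod_cast (by linarith : (1 : ℝ) ≤ d)
  · rw [div_le_one hs0]; exact ha3
  · refine le_trans ?_ (binom_tail m s0 s1 δ (by exact_mod_cast hmpos) (by omega) hs1m hδ0 hδ8)
    have e1 : a ^ 3 / s = Real.exp (-(2 * c ^ 2 + ε) * L) := by
      rw [ha, hsL, ← Real.exp_nat_mul, ← Real.exp_sub]
      congr 1
      push_cast
      rw [hε]; ring
    have b1 : 4 * (s1 : ℝ) ^ 2 / m ≤ 144 := by
      rw [div_le_iff₀ hmpos]
      have h9 : (s1 : ℝ) ^ 2 ≤ (3 * s) ^ 2 := pow_le_pow_left₀ hs1n hs13 2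
      have h10 : (3 * s) ^ 2 = 9 * d := by rw [← hsd]; ring
      linarith
    have b2 : 8 * δ * s1 ≤ 24 * Real.sqrt L := by
      calc 8 * δ * s1 ≤ 8 * δ * (3 * s) := by gcongr
        _ = 24 * (δ * s) := by ring
        _ = 24 * (c * Real.sqrt L) := by rw [hδs]
        _ ≤ 24 * Real.sqrt L := by
          have h0 : c * Real.sqrt L ≤ 1 * Real.sqrt L :=
            mul_le_mul_of_nonneg_right (by linarith) hsqL0
          linarith
    have b3 : 4 * δ ^ 2 * m ≤ 2 * c ^ 2 * L := by
      calc 4 * δ ^ 2 * m ≤ 4 * δ ^ 2 * (d / 2) := by gcongr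
        _ = 2 * (δ ^ 2 * d) := by ring
        _ = _ := by rw [hδ2]; ring
    have b4 : 32 * δ ^ 4 * m ≤ 1 := by
      have h1 : (32 * δ ^ 4 * m) * d ≤ 1 * d := by
        calc (32 * δ ^ 4 * m) * d ≤ (32 * δ ^ 4 * (d / 2)) * d := by gcongr
          _ = 16 * (δ ^ 2 * d) ^ 2 := by ring
          _ = 16 * (c ^ 2) ^ 2 * L ^ 2 := by rw [hδ2]; ring
          _ ≤ 1 * L ^ 2 := by
            gcongr
            have h0 : (c ^ 2) ^ 2 ≤ (1 / 4) ^ 2 := pow_le_pow_left₀ hc2'.le hc2.le 2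
            linarith
          _ ≤ 1 * d := by gcongr
      exact le_of_mul_le_mul_right h1 hdpos
    have b5 : 1 / 2 ≤ ((s1 : ℝ) - s0) / (2 * Real.sqrt m) := by
      have hsm : Real.sqrt m ≤ s := Real.sqrt_le_sqrt (by linarith)
      have hsm0 : 0 < Real.sqrt m := Real.sqrt_pos.2 hmpos
      rw [le_div_iff₀ (by positivity), hs1c]
      linarith
    calc a ^ 3 / s = Real.exp (-(2 * c ^ 2 + ε) * L) := e1
      _ ≤ Real.exp (-1 + -(145 + 24 * Real.sqrt L + 2 * c ^ 2 * L)) :=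
        Real.exp_le_exp.2 (by
          have h0 : -(2 * c ^ 2 + ε) * L = -(2 * c ^ 2 * L) - ε * L := by ring
          rw [h0]; linarith)
      _ = Real.exp (-1) * Real.exp (-(145 + 24 * Real.sqrt L + 2 * c ^ 2 * L)) :=
        Real.exp_add _ _
      _ ≤ ((s1 : ℝ) - s0) / (2 * Real.sqrt m) * Real.exp (-(4 * (s1 : ℝ) ^ 2 / m + 8 * δ * s1
          + 4 * δ ^ 2 * m + 32 * δ ^ 4 * m)) := by
        apply mul_le_mul (hhalf.trans b5) _ (Real.exp_pos _).le
        · linarith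
        · apply Real.exp_le_exp.2
          linarith
  · have hkd : (k : ℝ) ≤ Real.exp L := by 
      rw [← hdL]
      have h0 : s * a ≤ s * s := by gcongr
      linarith
    have hμr : a / 4 ≤ a ^ 3 / s / 2 * r := by
      calc a / 4 ≤ a ^ 2 / 4 := by
            have h0 : a ≤ a ^ 2 := le_self_pow₀ ha1 (by norm_num)
            linarith
        _ = a ^ 3 / s / 2 * (s / a / 2) := by field_simp; ring
        _ ≤ _ := by gcongr
    calc (k : ℝ) * Real.exp (-(a ^ 3 / s / 2 * r)) ≤ Real.exp L * Real.exp (-(a / 4)) := by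
          gcongr
      _ = Real.exp (L + -(a / 4)) := (Real.exp_add _ _).symm
      _ ≤ _ := hexp _ (by linarith)
  · refine ⟨1 / s, by positivity, ?_, ?_⟩
    · rw [div_le_one hs0]; linarith
    · apply hexp
      have e1 : 2 * (d : ℝ) * ((1 / s) ^ 2 / 4 + 1 / s * δ) = 1 / 2 + 2 * (δ * s) := by
        rw [← hsd]; field_simp; ring
      have e2 : a / 8 ≤ 1 / s * k := by
        calc a / 8 = 1 / s * (s * a / 8) := by field_simp
          _ ≤ _ := by gcongr
      rw [e1, hδs]
      have h0 : c * Real.sqrt L ≤ 1 / 2 * Real.sqrt L :=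
        mul_le_mul_of_nonneg_right hc.le hsqL0
      linarith

end Params

section Final

lemma round_two (K : ℕ) (c : ℝ) (hc0 : 0 < c) (hc : c < 1 / 2) : ∃ N : ℕ, ∀ d : ℕ, N ≤ d →
    (0 ≤ c * Real.sqrt (Real.log d / d) ∧ c * Real.sqrt (Real.log d / d) ≤ 1 / 8) ∧
    ∀ (V : Type) [Finite V], ∀ G : SimpleGraph V, P1 K G → P2 K G → P3 K G → ∀ v : V,
      deg G v ≤ d + 9 * K → d ≤ deg G v + 9 * K →
      prob (1 / 2 - c * Real.sqrt (Real.log d / d)) (fun A => v ∉ bootIter G A 2)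
        ≤ ((d : ℝ) ^ 5)⁻¹ := by
  obtain ⟨N, hN⟩ := params K c hc0 hc
  refine ⟨N, ?_⟩
  intro d hd
  obtain ⟨r, k, m, s0, s1, μ, hδ0, hδ8, q1, q2, q3, q4, q5, q6, hμ0, hμ1, hμ, hk, l, hl0, hl1, hl⟩
    := hN d hd
  refine ⟨⟨hδ0, hδ8⟩, ?_⟩
  intro V _ G h1 h2 h3 v hv1 hv2
  set δ := c * Real.sqrt (Real.log d / d) with hδ
  have hp0 : 0 ≤ 1 / 2 - δ := by linarith
  have hp1 : 1 / 2 - δ ≤ 1 := by linarith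
  have hts := two_step G h2 h3 hp0 hp1 v r k m s0 μ (by omega) (by
    intro y hy
    have := deg_le_of_P1 G h1 ((adj_mem_sphere_one G).2 hy)
    omega) (by
    intro P hP
    refine hμ.trans ?_
    have := prob_binom_ge hp0 hp1 P ((m + s0 : ℕ) : ℝ) (Finset.Icc (m + s0) (m + s1)) (by
      intro j hj
      rw [Finset.mem_Icc] at hj
      refine ⟨by omega, by exact_mod_cast hj.1⟩)
    rwa [hP] at this)
  refine hts.trans ?_
  have t1 : (k : ℝ) * (1 - (1 - (1 / 2 - δ)) * μ) ^ r ≤ ((d : ℝ) ^ 5)⁻¹ / 2 := by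
    refine le_trans ?_ hk
    apply mul_le_mul_of_nonneg_left _ (by positivity)
    have e : Real.exp (-(μ / 2 * r)) = Real.exp (-(μ / 2)) ^ r := by
      rw [← Real.exp_nat_mul]; congr 1; ring
    rw [e]
    apply pow_le_pow_left₀
    · nlinarith
    · have := Real.add_one_le_exp (-(μ / 2))
      nlinarith
  have t2 : prob (1 / 2 - δ) (fun A => ((G.neighborSet v ∩ A).ncard : ℝ) <
      (deg G v : ℝ) / 2 - k) ≤ ((d : ℝ) ^ 5)⁻¹ / 2 := by
    refine (prob_chernoff hp0 hp1 (G.neighborSet v) _ l hl0).trans (le_trans ?_ hl)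
    change Real.exp (l * ((deg G v : ℝ) / 2 - k)) *
      ((1 / 2 - δ) * Real.exp (-l) + (1 - (1 / 2 - δ))) ^ (deg G v) ≤ _
    have hf := chernoff_factor hδ0 (by linarith) hl0 hl1
    have hf0 : 0 ≤ (1 / 2 - δ) * Real.exp (-l) + (1 - (1 / 2 - δ)) := by
      have := mul_nonneg hp0 (Real.exp_pos (-l)).le
      linarith
    refine (mul_le_mul_of_nonneg_left (pow_le_pow_left₀ hf0 hf _) (Real.exp_pos _).le).trans ?_
    rw [← Real.exp_nat_mul, ← Real.exp_add]
    apply Real.exp_le_exp.2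
    have hn : (deg G v : ℝ) ≤ 2 * d := by exact_mod_cast (by omega : deg G v ≤ 2 * d)
    have h0 : 0 ≤ l ^ 2 / 4 + l * δ := by positivity
    have := mul_le_mul_of_nonneg_right hn h0
    linarith
  linarith

lemma minDeg_le {V : Type} (G : SimpleGraph V) (x : V) : minDeg G ≤ deg G x :=
  Nat.sInf_le ⟨x, rfl⟩

end Final


section Main

lemma floor_half (n C : ℕ) (hC : 0 < C) (h : C ≤ n) :
    (n : ℝ) / (2 * C) ≤ ((n / C : ℕ) : ℝ) := by
  have h1 : 1 ≤ n / C := (Nat.one_le_div_iff hC).2 h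
  have h2 : n < C * (n / C + 1) := Nat.lt_mul_div_succ n hC
  have h3 : n ≤ (n / C) * (2 * C) := by nlinarith
  have hC' : (0 : ℝ) < C := by exact_mod_cast hC
  rw [div_le_iff₀ (by positivity)]
  exact_mod_cast h3

lemma exp_beats (C : ℕ) (hC : 0 < C) : ∀ᶠ d : ℕ in atTop,
    (2 * (d : ℝ)) ^ 6 ≤ Real.exp ((d : ℝ) / (8 * C)) := by
  have hC' : (0 : ℝ) < C := by exact_mod_cast hC
  have hb : (0 : ℝ) < 1 / (8 * C) := by positivity
  have h := (isLittleO_pow_exp_pos_mul_atTop 6 hb).bound (by norm_num : (0 : ℝ) < 1 / 64)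
  have h' := tendsto_natCast_atTop_atTop (R := ℝ) |>.eventually h
  filter_upwards [h'] with d hd
  rw [Real.norm_of_nonneg (by positivity), Real.norm_of_nonneg (Real.exp_pos _).le] at hd
  have e : (1 : ℝ) / (8 * C) * d = d / (8 * C) := by ring
  rw [e] at hd
  have e2 : (2 * (d : ℝ)) ^ 6 = 64 * (d : ℝ) ^ 6 := by ring
  rw [e2]
  linarith

lemma deg_near {K : ℕ} {V : Type} [Finite V] (G : SimpleGraph V) (h1 : P1 K G) {x y : V} {r : ℕ}
    (hy : y ∈ ball G x r) : deg G y ≤ deg G x + K * r ∧ deg G x ≤ deg G y + K * r := by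
  have hy' : G.edist x y ≤ r := hy
  have hne : G.edist x y ≠ ⊤ := ne_top_of_le_ne_top (ENat.natCast_ne_top r) hy'
  obtain ⟨j, hj⟩ := ENat.ne_top_iff_exists.1 hne
  have hjr : j ≤ r := by
    rw [← hj] at hy'
    exact_mod_cast hy'
  have := deg_le_of_P1 G h1 (show y ∈ sphere G x j from hj.symm)
  have h2 : K * j ≤ K * r := Nat.mul_le_mul_left K hjr
  omega

lemma ball_trans {V : Type} (G : SimpleGraph V) {x y z : V} {r s : ℕ}
    (hy : y ∈ ball G x r) (hz : z ∈ ball G y s) : z ∈ ball G x (r + s) := by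
  have hy' : G.edist x y ≤ r := hy
  have hz' : G.edist y z ≤ s := hz
  change G.edist x z ≤ ((r + s : ℕ) : ℕ∞)
  push_cast
  exact (SimpleGraph.edist_triangle).trans (add_le_add hy' hz')

lemma deg_eq_zero_of_card_one {V : Type} (G : SimpleGraph V) (h : Nat.card V = 1) (x : V) :
    deg G x = 0 := by
  have hs : Subsingleton V := (Nat.card_eq_one_iff_unique.1 h).1
  have : G.neighborSet x = ∅ := by
    ext y
    simp only [SimpleGraph.mem_neighborSet, Set.mem_empty_iff_false, iff_false]
    intro hxy
    exact hxy.ne (Subsingleton.elim _ _)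
  rw [deg, this, Set.ncard_empty]

lemma InH_props {K : ℕ} {V : Type} (G : SimpleGraph V) (hG : InH K G) (x : V)
    (hx : 1 ≤ deg G x) : P1 K G ∧ P2 K G ∧ P3 K G := by
  obtain ⟨n, hn⟩ := hG
  have hcard : Nat.card V ≠ 1 := by
    intro h
    have := deg_eq_zero_of_card_one G h x
    omega
  cases n with
  | zero => exact absurd hn hcard
  | succ n =>
    rcases hn with h | ⟨a, b, c, _, _⟩
    · exact absurd h hcard
    · exact ⟨a, b, c⟩

lemma K_pos {K : ℕ} {V : Type} [Finite V] (G : SimpleGraph V) (h2 : P2 K G) (x : V)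
    (hx : 1 ≤ deg G x) : 1 ≤ K := by
  have hne : (G.neighborSet x).Nonempty := by
    rw [← Set.ncard_pos (Set.toFinite _)]; exact hx
  obtain ⟨y, hy⟩ := hne
  have := h2 x 1 le_rfl y ((adj_mem_sphere_one G).2 hy)
  have hpos : 0 < (G.neighborSet y ∩ ball G x 1).ncard := by
    rw [Set.ncard_pos (Set.toFinite _)]
    refine ⟨x, SimpleGraph.Adj.symm hy, ?_⟩
    change G.edist x x ≤ _
    simp
  omega

lemma final_bound (C3 C6 d : ℕ) (h3 : 0 < C3) (h6 : 0 < C6) (hd : C6 ≤ d)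
    (hb : (2 * (d : ℝ)) ^ 6 ≤ Real.exp ((d : ℝ) / (8 * C3))) :
    ((2 * (d : ℝ)) ^ 6 * Real.exp (-((d : ℝ) / (4 * C3)))) ^ (d / C6) ≤
      Real.exp (-(1 / (16 * C3 * C6) * (d : ℝ) ^ 2)) := by
  have h3' : (0 : ℝ) < C3 := by exact_mod_cast h3
  have h6' : (0 : ℝ) < C6 := by exact_mod_cast h6
  have hbase : (2 * (d : ℝ)) ^ 6 * Real.exp (-((d : ℝ) / (4 * C3))) ≤
      Real.exp (-((d : ℝ) / (8 * C3))) := by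
    calc _ ≤ Real.exp ((d : ℝ) / (8 * C3)) * Real.exp (-((d : ℝ) / (4 * C3))) := by gcongr
      _ = Real.exp (-((d : ℝ) / (8 * C3))) := by
        rw [← Real.exp_add]; congr 1; field_simp; ring
  refine (pow_le_pow_left₀ (by positivity) hbase _).trans ?_
  rw [← Real.exp_nat_mul]
  apply Real.exp_le_exp.2
  have hf := floor_half d C6 h6 hd
  have h0 : (0 : ℝ) ≤ (d : ℝ) / (8 * C3) := by positivity
  have hm := mul_le_mul_of_nonneg_right hf h0
  have e : (d : ℝ) / (2 * C6) * ((d : ℝ) / (8 * C3)) = 1 / (16 * C3 * C6) * (d : ℝ) ^ 2 := by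
    field_simp; ring
  rw [e] at hm
  linarith

lemma mid_bound (C3 d n : ℕ) (h3 : 0 < C3) (hn1 : n ≤ 2 * d) (hn2 : d ≤ 2 * n) (hd : C3 ≤ n)
    (hd16 : 16 ≤ d) :
    ((2 * (n : ℝ)) ^ 3 * ((d : ℝ) ^ 5)⁻¹) ^ (n / C3) ≤ Real.exp (-((d : ℝ) / (4 * C3))) := by
  have h3' : (0 : ℝ) < C3 := by exact_mod_cast h3
  have hd' : (16 : ℝ) ≤ d := by exact_mod_cast hd16
  have hn1' : (n : ℝ) ≤ 2 * d := by exact_mod_cast hn1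
  have hn2' : (d : ℝ) ≤ 2 * n := by exact_mod_cast hn2
  have hd0 : (0 : ℝ) < d := by linarith
  have hbase : (2 * (n : ℝ)) ^ 3 * ((d : ℝ) ^ 5)⁻¹ ≤ Real.exp (-1) := by
    calc (2 * (n : ℝ)) ^ 3 * ((d : ℝ) ^ 5)⁻¹ ≤ (2 * (2 * (d : ℝ))) ^ 3 * ((d : ℝ) ^ 5)⁻¹ := by
          gcongr
      _ = 64 / (d : ℝ) ^ 2 := by field_simp; ring
      _ ≤ 64 / (16 : ℝ) ^ 2 := by gcongr
      _ ≤ Real.exp (-1) := by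
        have := Real.exp_one_lt_d9
        rw [Real.exp_neg, le_inv_comm₀ (by norm_num) (Real.exp_pos _)]
        norm_num
        linarith
  refine (pow_le_pow_left₀ (by positivity) hbase _).trans ?_
  rw [← Real.exp_nat_mul]
  apply Real.exp_le_exp.2
  have hf := floor_half n C3 h3 hd
  have hq : (d : ℝ) / (4 * C3) ≤ (n : ℝ) / (2 * C3) := by
    rw [div_le_div_iff₀ (by positivity) (by positivity)]
    nlinarith
  linarith

lemma main_pos (K : ℕ) (hK : 1 ≤ K) (c : ℝ) (hc0 : 0 < c) (hc : c < 1 / 2) :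
    ∃ β : ℝ, 0 < β ∧ ∃ D₀ : ℕ, 1 ≤ D₀ ∧ ∀ (V : Type) [Finite V], ∀ G : SimpleGraph V,
      P1 K G → P2 K G → P3 K G → ∀ x : V, D₀ ≤ deg G x →
      prob (1 / 2 - c * Real.sqrt (Real.log (deg G x) / (deg G x)))
          (fun A0 => x ∉ bootIter G A0 11)
        ≤ Real.exp (-(β * (deg G x : ℝ) ^ 2)) := by
  obtain ⟨C3, hC3⟩ : ∃ C : ℕ, C = (4 * K * 3) ^ 3 * (3 * K ^ (3 - 1)) := ⟨_, rfl⟩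
  obtain ⟨C6, hC6⟩ : ∃ C : ℕ, C = (4 * K * 6) ^ 6 * (6 * K ^ (6 - 1)) := ⟨_, rfl⟩
  have h3 : 0 < C3 := by rw [hC3]; positivity
  have h6 : 0 < C6 := by rw [hC6]; positivity
  have h3' : (0 : ℝ) < C3 := by exact_mod_cast h3
  have h6' : (0 : ℝ) < C6 := by exact_mod_cast h6
  obtain ⟨N1, hN1⟩ := round_two K c hc0 hc
  obtain ⟨N2, hN2⟩ := eventually_atTop.1 (exp_beats C3 h3)
  refine ⟨1 / (16 * C3 * C6), by positivity, N1 + N2 + 2 * C3 + C6 + 200 * K + 16, by omega, ?_⟩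
  intro V _ G p1 p2 p3 x hx
  obtain ⟨d, hd⟩ : ∃ d, d = deg G x := ⟨_, rfl⟩
  rw [← hd] at hx ⊢
  obtain ⟨⟨hδ0, hδ8⟩, hr⟩ := hN1 d (by omega)
  set p := 1 / 2 - c * Real.sqrt (Real.log d / d) with hp
  have hp0 : 0 ≤ p := by linarith
  have hp1 : p ≤ 1 := by linarith
  have hq2 : ∀ y ∈ ball G x 9, prob p (fun A => y ∉ bootIter G A 2) ≤ ((d : ℝ) ^ 5)⁻¹ := by
    intro y hy
    have := deg_near G p1 hy
    exact hr V G p1 p2 p3 y (by omega) (by omega)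
  have hq5 : ∀ v ∈ ball G x 6, prob p (fun A => v ∉ bootIter G A 5) ≤
      Real.exp (-((d : ℝ) / (4 * C3))) := by
    intro v hv
    have hdeg := deg_near G p1 hv
    have ha := amplify G p1 p2 p3 hp0 hp1 v 2 3 (by norm_num) (by omega) ((d : ℝ) ^ 5)⁻¹
      (fun y hy => hq2 y (ball_trans G hv hy))
    rw [← hC3] at ha
    exact ha.trans (mid_bound C3 d (deg G v) h3 (by omega) (by omega) (by omega) (by omega))
  have ha := amplify G p1 p2 p3 hp0 hp1 x 5 6 (by norm_num) (by omega) _ hq5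
  rw [← hC6, ← hd] at ha
  exact ha.trans (final_bound C3 C6 d h3 h6 (by omega) (hN2 d (by omega)))

end Main


/-- Lemma: super-exponential bound after eleven rounds. -/
theorem statement6 (K : ℕ) (c : ℝ) (hc0 : 0 < c) (hc : c < 1 / 2) :
    ∃ β : ℝ, 0 < β ∧ ∃ D₀ : ℕ, ∀ (V : Type) [Finite V], ∀ G : SimpleGraph V,
      InH K G → D₀ ≤ minDeg G → ∀ x : V,
      prob (1 / 2 - c * Real.sqrt (Real.log (deg G x) / (deg G x)))
          (fun A0 => x ∉ bootIter G A0 11)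
        ≤ Real.exp (-(β * (deg G x : ℝ) ^ 2)) := by
  rcases Nat.eq_zero_or_pos K with hK | hK
  · refine ⟨1, one_pos, 1, ?_⟩
    intro V _ G hG hmin x
    have hx : 1 ≤ deg G x := hmin.trans (minDeg_le G x)
    have h := K_pos G (InH_props G hG x hx).2.1 x hx
    omega
  · obtain ⟨β, hβ, D, hD, h⟩ := main_pos K hK c hc0 hc
    refine ⟨β, hβ, D, ?_⟩
    intro V _ G hG hmin x
    have hx : D ≤ deg G x := hmin.trans (minDeg_le G x)
    obtain ⟨a, b, e⟩ := InH_props G hG x (hD.trans hx)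
    exact h V G a b e x hx

end MBP
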